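/- The ∀,∃-free (but possibly ⊓,⊔,⊓x,⊔x-containing) fragment of the system CL2 is decidable: there is an algorithm that decides, for any formula F without blind quantifiers, whether CL2 ⊢ F. -/

import Mathlib

/-- Terms of the language: variables and constants (both indexed by naturals). -/
inductive Term where
  | var : ℕ → Term
  | const : ℕ → Term
deriving DecidableEq

/-- Formulas of the language of CL2: the logical atoms ⊤,⊥, non-logical atoms
p(t₁,…,tₙ), the classical connectives ¬,∧,∨,→, the blind quantifiers ∀x,∃x, the
choice connectives ⊓,⊔ and the choice quantifiers ⊓x,⊔x. -/
inductive Fml where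
  | top : Fml
  | bot : Fml
  | atom : ℕ → List Term → Fml
  | neg : Fml → Fml
  | and : Fml → Fml → Fml
  | or : Fml → Fml → Fml
  | imp : Fml → Fml → Fml
  | all : ℕ → Fml → Fml
  | ex : ℕ → Fml → Fml
  | chand : Fml → Fml → Fml
  | chor : Fml → Fml → Fml
  | chall : ℕ → Fml → Fml
  | chex : ℕ → Fml → Fml

/-- Substitution of the term u for the variable x in a term. -/
def Term.subst (t : Term) (x : ℕ) (u : Term) : Term :=
  match t with
  | .var y => if y = x then u else .var y
  | .const c => .const c

/-- Substitution of the term u for all free occurrences of the variable x. -/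
def Fml.subst : Fml → ℕ → Term → Fml
  | .top, _, _ => .top
  | .bot, _, _ => .bot
  | .atom p args, x, u => .atom p (args.map fun t => t.subst x u)
  | .neg F, x, u => .neg (F.subst x u)
  | .and F G, x, u => .and (F.subst x u) (G.subst x u)
  | .or F G, x, u => .or (F.subst x u) (G.subst x u)
  | .imp F G, x, u => .imp (F.subst x u) (G.subst x u)
  | .all y F, x, u => if y = x then .all y F else .all y (F.subst x u)
  | .ex y F, x, u => if y = x then .ex y F else .ex y (F.subst x u)
  | .chand F G, x, u => .chand (F.subst x u) (G.subst x u)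
  | .chor F G, x, u => .chor (F.subst x u) (G.subst x u)
  | .chall y F, x, u => if y = x then .chall y F else .chall y (F.subst x u)
  | .chex y F, x, u => if y = x then .chex y F else .chex y (F.subst x u)

/-- Elementarization, relative to a sign (true = positive occurrence): positive
surface occurrences of ⊔-type subformulas become ⊥ and of ⊓-type become ⊤, and
dually for negative occurrences; → is read as flipping the sign of its
antecedent. -/
def Fml.elzAux : Bool → Fml → Fml
  | _, .top => .top
  | _, .bot => .bot
  | _, .atom p args => .atom p args
  | s, .neg F => .neg (Fml.elzAux (!s) F)
  | s, .and F G => .and (Fml.elzAux s F) (Fml.elzAux s G)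
  | s, .or F G => .or (Fml.elzAux s F) (Fml.elzAux s G)
  | s, .imp F G => .imp (Fml.elzAux (!s) F) (Fml.elzAux s G)
  | s, .all x F => .all x (Fml.elzAux s F)
  | s, .ex x F => .ex x (Fml.elzAux s F)
  | s, .chand _ _ => if s then .top else .bot
  | s, .chor _ _ => if s then .bot else .top
  | s, .chall _ _ => if s then .top else .bot
  | s, .chex _ _ => if s then .bot else .top

/-- The elementarization ‖F‖ of a formula F. -/
def Fml.elz (F : Fml) : Fml := Fml.elzAux true F

/-- The value of a term under a valuation (constants denote themselves). -/
def Term.val (v : ℕ → ℕ) : Term → ℕ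
  | .var x => v x
  | .const c => c

/-- Classical satisfaction of a formula, in the model with domain the constants
{0,1,2,…}, where I interprets the predicate letters and v the variables.
(Used only on elementary formulas; choice operators are read classically.) -/
def Fml.sat (I : ℕ → List ℕ → Prop) : (ℕ → ℕ) → Fml → Prop
  | _, .top => True
  | _, .bot => False
  | v, .atom p args => I p (args.map (Term.val v))
  | v, .neg F => ¬ Fml.sat I v F
  | v, .and F G => Fml.sat I v F ∧ Fml.sat I v G
  | v, .or F G => Fml.sat I v F ∨ Fml.sat I v G
  | v, .imp F G => Fml.sat I v F → Fml.sat I v G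
  | v, .all x F => ∀ c : ℕ, Fml.sat I (Function.update v x c) F
  | v, .ex x F => ∃ c : ℕ, Fml.sat I (Function.update v x c) F
  | v, .chand F G => Fml.sat I v F ∧ Fml.sat I v G
  | v, .chor F G => Fml.sat I v F ∨ Fml.sat I v G
  | v, .chall x F => ∀ c : ℕ, Fml.sat I (Function.update v x c) F
  | v, .chex x F => ∃ c : ℕ, Fml.sat I (Function.update v x c) F

/-- Classical validity (constants read as free variables, i.e. true under every
interpretation of the predicate letters and every valuation). -/
def Fml.Valid (F : Fml) : Prop := ∀ (I : ℕ → List ℕ → Prop) (v : ℕ → ℕ), F.sat I v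

/-- A formula is stable iff its elementarization is classically valid. -/
def Fml.Stable (F : Fml) : Prop := F.elz.Valid

/-- Variables occurring in a term. -/
def Term.vars : Term → Finset ℕ
  | .var x => {x}
  | .const _ => ∅

/-- All variables occurring (free or bound) in a formula. -/
def Fml.vars : Fml → Finset ℕ
  | .top => ∅
  | .bot => ∅
  | .atom _ args => args.foldr (fun t s => t.vars ∪ s) ∅
  | .neg F => F.vars
  | .and F G | .or F G | .imp F G | .chand F G | .chor F G => F.vars ∪ G.vars
  | .all x F | .ex x F | .chall x F | .chex x F => insert x F.vars

/-- The free variables of a formula. -/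
def Fml.freeVars : Fml → Finset ℕ
  | .top => ∅
  | .bot => ∅
  | .atom _ args => args.foldr (fun t s => t.vars ∪ s) ∅
  | .neg F => F.freeVars
  | .and F G | .or F G | .imp F G | .chand F G | .chor F G => F.freeVars ∪ G.freeVars
  | .all x F | .ex x F | .chall x F | .chex x F => F.freeVars.erase x

/-- `F.capturesAt x v` : some free occurrence of the variable x in F lies in
the scope of a quantifier (∀, ∃, ⊓ or ⊔) binding the variable v. -/
def Fml.capturesAt : Fml → ℕ → ℕ → Prop
  | .top, _, _ => False
  | .bot, _, _ => False
  | .atom _ _, _, _ => False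
  | .neg F, x, v => F.capturesAt x v
  | .and F G, x, v | .or F G, x, v | .imp F G, x, v
  | .chand F G, x, v | .chor F G, x, v => F.capturesAt x v ∨ G.capturesAt x v
  | .all y F, x, v | .ex y F, x, v | .chall y F, x, v | .chex y F, x, v =>
      x ≠ y ∧ ((y = v ∧ x ∈ F.freeVars) ∨ F.capturesAt x v)

/-- A path addressing a surface occurrence in a formula (surface = not in the
scope of any choice operator, so paths do not descend through ⊓,⊔,⊓x,⊔x). -/
inductive FPath where
  | here : FPath
  | negP : FPath → FPath
  | andL : FPath → FPath
  | andR : FPath → FPath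
  | orL : FPath → FPath
  | orR : FPath → FPath
  | impL : FPath → FPath
  | impR : FPath → FPath
  | allP : FPath → FPath
  | exP : FPath → FPath

/-- The subformula of F at a surface path, together with its sign (true =
positive, i.e. in the scope of an even number of negations, reading G → H as
¬G ∨ H) and the set of variables bound by blind quantifiers on the path. -/
def Fml.subAt : Fml → FPath → Option (Bool × Finset ℕ × Fml)
  | F, .here => some (true, ∅, F)
  | .neg F, .negP π => (F.subAt π).map fun r => (!r.1, r.2.1, r.2.2)
  | .and F _, .andL π => F.subAt π
  | .and _ G, .andR π => G.subAt π
  | .or F _, .orL π => F.subAt π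
  | .or _ G, .orR π => G.subAt π
  | .imp F _, .impL π => (F.subAt π).map fun r => (!r.1, r.2.1, r.2.2)
  | .imp _ G, .impR π => G.subAt π
  | .all x F, .allP π => (F.subAt π).map fun r => (r.1, insert x r.2.1, r.2.2)
  | .ex x F, .exP π => (F.subAt π).map fun r => (r.1, insert x r.2.1, r.2.2)
  | _, _ => none

/-- The result of replacing the subformula at a surface path by H. -/
def Fml.replaceAt : Fml → FPath → Fml → Option Fml
  | _, .here, H => some H
  | .neg F, .negP π, H => (F.replaceAt π H).map Fml.neg
  | .and F G, .andL π, H => (F.replaceAt π H).map fun F' => .and F' G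
  | .and F G, .andR π, H => (G.replaceAt π H).map fun G' => .and F G'
  | .or F G, .orL π, H => (F.replaceAt π H).map fun F' => .or F' G
  | .or F G, .orR π, H => (G.replaceAt π H).map fun G' => .or F G'
  | .imp F G, .impL π, H => (F.replaceAt π H).map fun F' => .imp F' G
  | .imp F G, .impR π, H => (G.replaceAt π H).map fun G' => .imp F G'
  | .all x F, .allP π, H => (F.replaceAt π H).map (Fml.all x)
  | .ex x F, .exP π, H => (F.replaceAt π H).map (Fml.ex x)
  | _, _, _ => none

/-- Provability in CL2, given by Rules A, B1 and B2. In Rule A, `ych` chooses,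
for each positive surface occurrence of a ⊓-quantified subformula (resp.
negative occurrence of a ⊔-quantified one), some variable not occurring in F. -/
inductive Prov : Fml → Prop where
  | ruleA (F : Fml) (hst : F.Stable) (ych : FPath → ℕ)
      (hfresh : ∀ π : FPath, ych π ∉ F.vars)
      (hcon : ∀ (π : FPath) (b : Finset ℕ) (G₁ G₂ : Fml),
        (F.subAt π = some (true, b, .chand G₁ G₂) ∨
         F.subAt π = some (false, b, .chor G₁ G₂)) →
        ∀ G : Fml, (G = G₁ ∨ G = G₂) →
        ∀ H : Fml, F.replaceAt π G = some H → Prov H)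
      (hqu : ∀ (π : FPath) (b : Finset ℕ) (x : ℕ) (G : Fml),
        (F.subAt π = some (true, b, .chall x G) ∨
         F.subAt π = some (false, b, .chex x G)) →
        ∀ H : Fml, F.replaceAt π (G.subst x (.var (ych π))) = some H → Prov H) :
      Prov F
  | ruleB1 (F F' : Fml) (π : FPath) (b : Finset ℕ) (G₁ G₂ G : Fml)
      (hocc : F.subAt π = some (false, b, .chand G₁ G₂) ∨
              F.subAt π = some (true, b, .chor G₁ G₂))
      (hG : G = G₁ ∨ G = G₂)
      (hrep : F.replaceAt π G = some F')
      (hprem : Prov F') : Prov F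
  | ruleB2 (F F' : Fml) (π : FPath) (b : Finset ℕ) (x : ℕ) (G : Fml) (t : Term)
      (hocc : F.subAt π = some (false, b, .chall x G) ∨
              F.subAt π = some (true, b, .chex x G))
      (hside : ∀ v : ℕ, t = .var v → v ∉ b ∧ ¬ G.capturesAt x v)
      (hrep : F.replaceAt π (G.subst x t) = some F')
      (hprem : Prov F') : Prov F

/-- A formula is free of blind quantifiers ∀,∃. -/
def Fml.blindFree : Fml → Prop
  | .top => True
  | .bot => True
  | .atom _ _ => True
  | .neg F => F.blindFree
  | .and F G | .or F G | .imp F G | .chand F G | .chor F G =>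
      F.blindFree ∧ G.blindFree
  | .all _ _ | .ex _ _ => False
  | .chall _ F | .chex _ F => F.blindFree

/-- A numerical code for terms. -/
def Term.code : Term → ℕ
  | .var x => 2 * x
  | .const c => 2 * c + 1

/-- A numerical code for lists of naturals. -/
def listCode : List ℕ → ℕ
  | [] => 0
  | n :: l => Nat.pair n (listCode l) + 1

/-- A numerical code for formulas. -/
def Fml.code : Fml → ℕ
  | .top => Nat.pair 0 0
  | .bot => Nat.pair 1 0
  | .atom p args => Nat.pair 2 (Nat.pair p (listCode (args.map Term.code)))
  | .neg F => Nat.pair 3 F.code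
  | .and F G => Nat.pair 4 (Nat.pair F.code G.code)
  | .or F G => Nat.pair 5 (Nat.pair F.code G.code)
  | .imp F G => Nat.pair 6 (Nat.pair F.code G.code)
  | .all x F => Nat.pair 7 (Nat.pair x F.code)
  | .ex x F => Nat.pair 8 (Nat.pair x F.code)
  | .chand F G => Nat.pair 9 (Nat.pair F.code G.code)
  | .chor F G => Nat.pair 10 (Nat.pair F.code G.code)
  | .chall x F => Nat.pair 11 (Nat.pair x F.code)
  | .chex x F => Nat.pair 12 (Nat.pair x F.code)


/-! ## Part 1 : one-step moves -/

/-- t may be substituted for x in G without being captured. -/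
def OkSub (G : Fml) (x : ℕ) (t : Term) : Prop :=
  ∀ v : ℕ, t = .var v → ¬ G.capturesAt x v

/-- A local move at a choice subformula occurring with sign s. -/
inductive Loc (t : Term) : Bool → Fml → Fml → Prop
  | chorL (A B : Fml) : Loc t true (.chor A B) A
  | chorR (A B : Fml) : Loc t true (.chor A B) B
  | chex (x : ℕ) (G : Fml) : OkSub G x t → Loc t true (.chex x G) (G.subst x t)
  | chandL (A B : Fml) : Loc t false (.chand A B) A
  | chandR (A B : Fml) : Loc t false (.chand A B) B
  | chall (x : ℕ) (G : Fml) : OkSub G x t → Loc t false (.chall x G) (G.subst x t)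

/-- A move somewhere on the surface of a formula. -/
inductive Step (t : Term) : Bool → Fml → Fml → Prop
  | loc {s F H} : Loc t s F H → Step t s F H
  | neg {s F F'} : Step t (!s) F F' → Step t s (.neg F) (.neg F')
  | andL {s F F'} (G : Fml) : Step t s F F' → Step t s (.and F G) (.and F' G)
  | andR {s G G'} (F : Fml) : Step t s G G' → Step t s (.and F G) (.and F G')
  | orL {s F F'} (G : Fml) : Step t s F F' → Step t s (.or F G) (.or F' G)
  | orR {s G G'} (F : Fml) : Step t s G G' → Step t s (.or F G) (.or F G')
  | impL {s F F'} (G : Fml) : Step t (!s) F F' → Step t s (.imp F G) (.imp F' G)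
  | impR {s G G'} (F : Fml) : Step t s G G' → Step t s (.imp F G) (.imp F G')

theorem Fml.blindFree_subst {F : Fml} {x : ℕ} {u : Term} (h : F.blindFree) :
    (F.subst x u).blindFree := by
  induction F with
  | top | bot | atom => simp [Fml.subst, Fml.blindFree]
  | neg F ih => exact ih h
  | and F G ihF ihG | or F G ihF ihG | imp F G ihF ihG | chand F G ihF ihG | chor F G ihF ihG =>
    exact ⟨ihF h.1, ihG h.2⟩
  | all | ex => exact h.elim
  | chall y F ih | chex y F ih =>
    simp only [Fml.subst]; split
    · exact h
    · exact ih h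

theorem Loc.blindFree {t s F H} (h : Loc t s F H) (hF : F.blindFree) : H.blindFree := by
  cases h with
  | chorL | chandL => exact hF.1
  | chorR | chandR => exact hF.2
  | chex | chall => exact Fml.blindFree_subst hF

theorem Step.blindFree {t s F H} (h : Step t s F H) (hF : F.blindFree) : H.blindFree := by
  induction h with
  | loc h => exact h.blindFree hF
  | neg _ ih => exact ih hF
  | andL _ _ ih | orL _ _ ih | impL _ _ ih => exact ⟨ih hF.1, hF.2⟩
  | andR _ _ ih | orR _ _ ih | impR _ _ ih => exact ⟨hF.1, ih hF.2⟩

theorem Step.path {t s F H} (h : Step t s F H) :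
    ∃ π r X Y, F.subAt π = some (r, ∅, X) ∧ Loc t (r == s) X Y ∧ 
      F.replaceAt π Y = some H := by
  induction h with
  | @loc s F H h =>
    refine ⟨.here, true, F, H, ?_, ?_, ?_⟩
    · cases F <;> rfl
    · simpa using h
    · cases F <;> rfl
  | neg _ ih =>
    obtain ⟨π, r, X, Y, h1, h2, h3⟩ := ih
    refine ⟨.negP π, !r, X, Y, by simp [Fml.subAt, h1], ?_, by simp [Fml.replaceAt, h3]⟩
    convert h2 using 1; cases r <;> simp
  | impL _ _ ih =>
    obtain ⟨π, r, X, Y, h1, h2, h3⟩ := ih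
    refine ⟨.impL π, !r, X, Y, by simp [Fml.subAt, h1], ?_, by simp [Fml.replaceAt, h3]⟩
    convert h2 using 1; cases r <;> simp
  | andL _ _ ih =>
    obtain ⟨π, r, X, Y, h1, h2, h3⟩ := ih
    exact ⟨.andL π, r, X, Y, by simp [Fml.subAt, h1], h2, by simp [Fml.replaceAt, h3]⟩
  | andR _ _ ih =>
    obtain ⟨π, r, X, Y, h1, h2, h3⟩ := ih
    exact ⟨.andR π, r, X, Y, by simp [Fml.subAt, h1], h2, by simp [Fml.replaceAt, h3]⟩
  | orL _ _ ih =>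
    obtain ⟨π, r, X, Y, h1, h2, h3⟩ := ih
    exact ⟨.orL π, r, X, Y, by simp [Fml.subAt, h1], h2, by simp [Fml.replaceAt, h3]⟩
  | orR _ _ ih =>
    obtain ⟨π, r, X, Y, h1, h2, h3⟩ := ih
    exact ⟨.orR π, r, X, Y, by simp [Fml.subAt, h1], h2, by simp [Fml.replaceAt, h3]⟩
  | impR _ _ ih =>
    obtain ⟨π, r, X, Y, h1, h2, h3⟩ := ih
    exact ⟨.impR π, r, X, Y, by simp [Fml.subAt, h1], h2, by simp [Fml.replaceAt, h3]⟩

theorem Step.of_path {t} (π : FPath) : ∀ {s F r b X Y H}, F.blindFree →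
    F.subAt π = some (r, b, X) → Loc t (r == s) X Y → F.replaceAt π Y = some H →
    Step t s F H := by
  induction π with
  | here =>
    intro s F r b X Y H _ h1 h2 h3
    have h1' : true = r ∧ ∅ = b ∧ F = X := by cases F <;> simpa [Fml.subAt] using h1
    have h3' : Y = H := by cases F <;> simpa [Fml.replaceAt] using h3
    obtain ⟨rfl, -, rfl⟩ := h1'
    subst h3'
    exact .loc (by simpa using h2)
  | negP π ih =>
    intro s F r b X Y H hF h1 h2 h3
    cases F <;> simp [Fml.subAt, Fml.replaceAt] at h1 h3
    obtain ⟨F', h3, rfl⟩ := h3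
    exact .neg (ih hF h1 (by convert h2 using 1; cases r <;> simp) h3)
  | impL π ih =>
    intro s F r b X Y H hF h1 h2 h3
    cases F <;> simp [Fml.subAt, Fml.replaceAt] at h1 h3
    obtain ⟨F', h3, rfl⟩ := h3
    exact .impL _ (ih hF.1 h1 (by convert h2 using 1; cases r <;> simp) h3)
  | andL π ih =>
    intro s F r b X Y H hF h1 h2 h3
    cases F <;> simp [Fml.subAt, Fml.replaceAt] at h1 h3
    obtain ⟨F', h3, rfl⟩ := h3
    exact .andL _ (ih hF.1 h1 h2 h3)
  | andR π ih =>
    intro s F r b X Y H hF h1 h2 h3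
    cases F <;> simp [Fml.subAt, Fml.replaceAt] at h1 h3
    obtain ⟨F', h3, rfl⟩ := h3
    exact .andR _ (ih hF.2 h1 h2 h3)
  | orL π ih =>
    intro s F r b X Y H hF h1 h2 h3
    cases F <;> simp [Fml.subAt, Fml.replaceAt] at h1 h3
    obtain ⟨F', h3, rfl⟩ := h3
    exact .orL _ (ih hF.1 h1 h2 h3)
  | orR π ih =>
    intro s F r b X Y H hF h1 h2 h3
    cases F <;> simp [Fml.subAt, Fml.replaceAt] at h1 h3
    obtain ⟨F', h3, rfl⟩ := h3
    exact .orR _ (ih hF.2 h1 h2 h3)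
  | impR π ih =>
    intro s F r b X Y H hF h1 h2 h3
    cases F <;> simp [Fml.subAt, Fml.replaceAt] at h1 h3
    obtain ⟨F', h3, rfl⟩ := h3
    exact .impR _ (ih hF.2 h1 h2 h3)
  | allP π ih | exP π ih =>
    intro s F r b X Y H hF h1 h2 h3
    cases F <;> simp [Fml.subAt, Fml.replaceAt] at h1 h3
    exact hF.elim

theorem Fml.capturesAt_mem_vars {G : Fml} {x v : ℕ} (h : G.capturesAt x v) : v ∈ G.vars := by
  induction G with
  | top | bot | atom => exact h.elim
  | neg F ih => exact ih h
  | and F G ihF ihG | or F G ihF ihG | imp F G ihF ihG | chand F G ihF ihG | chor F G ihF ihG =>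
    simp only [Fml.vars, Finset.mem_union]
    exact h.imp ihF ihG
  | all y F ih | ex y F ih | chall y F ih | chex y F ih =>
    simp only [Fml.vars, Finset.mem_insert]
    exact h.2.imp (fun h => h.1.symm) ih

theorem Fml.subAt_vars (π : FPath) : ∀ {F : Fml} {r b X}, F.subAt π = some (r, b, X) →
    X.vars ⊆ F.vars := by
  induction π with
  | here => intro F r b X h; cases F <;> simp [Fml.subAt] at h <;> rw [h.2.2]
  | negP π ih | impL π ih | allP π ih | exP π ih =>
    intro F r b X h
    cases F <;> simp only [Fml.subAt, Option.map_eq_some_iff, reduceCtorEq] at h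
    obtain ⟨⟨r', b', X'⟩, h, h'⟩ := h
    obtain rfl : X' = X := congrArg (fun q => q.2.2) h'
    intro z hz
    simp [Fml.vars, ih h hz]
  | andL π ih | andR π ih | orL π ih | orR π ih | impR π ih =>
    intro F r b X h
    cases F <;> simp [Fml.subAt] at h
    intro z hz
    simp [Fml.vars, ih h hz]

/-! ## Part 2 : propositional evaluation of the elementarization -/

/-- Truth value of the elementarization of F at sign s. -/
def Fml.pev (A : ℕ → List Term → Bool) : Bool → Fml → Bool
  | _, .top => true
  | _, .bot => false
  | _, .atom p args => A p args
  | s, .neg F => !(Fml.pev A (!s) F)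
  | s, .and F G => Fml.pev A s F && Fml.pev A s G
  | s, .or F G => Fml.pev A s F || Fml.pev A s G
  | s, .imp F G => !(Fml.pev A (!s) F) || Fml.pev A s G
  | _, .all _ _ => true
  | _, .ex _ _ => true
  | s, .chand _ _ => s
  | s, .chor _ _ => !s
  | s, .chall _ _ => s
  | s, .chex _ _ => !s

def Fml.Taut (F : Fml) : Prop := ∀ A, F.pev A true = true

/-- All variable and constant indices in a term are below N. -/
def Term.bnd (N : ℕ) : Term → Prop
  | .var x => x < N
  | .const c => c < N

/-- All variable and constant indices in a formula are below N. -/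
def Fml.bnd (N : ℕ) : Fml → Prop
  | .top => True
  | .bot => True
  | .atom _ args => ∀ t ∈ args, t.bnd N
  | .neg F => F.bnd N
  | .and F G | .or F G | .imp F G | .chand F G | .chor F G => F.bnd N ∧ G.bnd N
  | .all x F | .ex x F | .chall x F | .chex x F => x < N ∧ F.bnd N

theorem mem_foldr_vars {args : List Term} {x : ℕ} :
    x ∈ args.foldr (fun t s => t.vars ∪ s) ∅ ↔ Term.var x ∈ args := by
  induction args with
  | nil => simp
  | cons t l ih =>
    simp only [List.foldr_cons, Finset.mem_union, ih, List.mem_cons]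
    cases t <;> simp [Term.vars]

theorem Fml.bnd_vars {N : ℕ} {F : Fml} (h : F.bnd N) {x : ℕ} (hx : x ∈ F.vars) : x < N := by
  induction F with
  | top | bot => simp [Fml.vars] at hx
  | atom p args => exact h _ (mem_foldr_vars.1 hx)
  | neg F ih => exact ih h hx
  | and F G ihF ihG | or F G ihF ihG | imp F G ihF ihG | chand F G ihF ihG | chor F G ihF ihG =>
    simp only [Fml.vars, Finset.mem_union] at hx
    exact hx.elim (ihF h.1) (ihG h.2)
  | all y F ih | ex y F ih | chall y F ih | chex y F ih =>
    simp only [Fml.vars, Finset.mem_insert] at hx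
    rcases hx with rfl | hx
    · exact h.1
    · exact ih h.2 hx

theorem Term.code_le_bnd {t : Term} {N : ℕ} (h : t.code < N) : t.bnd N := by
  cases t <;> simp only [Term.code, Term.bnd] at * <;> omega

theorem mem_le_listCode {l : List ℕ} {a : ℕ} (h : a ∈ l) : a ≤ listCode l := by
  induction l with
  | nil => simp at h
  | cons b l ih =>
    simp only [listCode]
    rcases List.mem_cons.1 h with rfl | h
    · exact (Nat.left_le_pair _ _).trans (Nat.le_succ _)
    · exact ((ih h).trans (Nat.right_le_pair _ _)).trans (Nat.le_succ _)

theorem Fml.bnd_of_code {N : ℕ} {F : Fml} (h : F.code < N) : F.bnd N := by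
  induction F with
  | top | bot => trivial
  | atom p args =>
    intro t ht
    apply Term.code_le_bnd
    refine lt_of_le_of_lt ?_ h
    refine (mem_le_listCode (List.mem_map_of_mem (f := Term.code) ht)).trans ?_
    exact (Nat.right_le_pair _ _).trans (Nat.right_le_pair _ _)
  | neg F ih => exact ih (lt_of_le_of_lt (Nat.right_le_pair _ _) h)
  | and F G ihF ihG | or F G ihF ihG | imp F G ihF ihG | chand F G ihF ihG | chor F G ihF ihG =>
    have h' := lt_of_le_of_lt (Nat.right_le_pair _ _) h
    exact ⟨ihF (lt_of_le_of_lt (Nat.left_le_pair _ _) h'),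
      ihG (lt_of_le_of_lt (Nat.right_le_pair _ _) h')⟩
  | all y F ih | ex y F ih | chall y F ih | chex y F ih =>
    have h' := lt_of_le_of_lt (Nat.right_le_pair _ _) h
    exact ⟨(lt_of_le_of_lt (Nat.left_le_pair _ _) h'),
      ih (lt_of_le_of_lt (Nat.right_le_pair _ _) h')⟩

theorem Fml.sat_elz_iff {N : ℕ} {I : ℕ → List ℕ → Prop} {v : ℕ → ℕ} {A : ℕ → List Term → Bool}
    (hIA : ∀ p args, (∀ t ∈ args, Term.bnd N t) → (I p (args.map (Term.val v)) ↔ A p args = true))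
    {F : Fml} (hF : F.blindFree) (hN : F.bnd N) (s : Bool) :
    (Fml.elzAux s F).sat I v ↔ F.pev A s = true := by
  induction F generalizing s with
  | top | bot => simp [Fml.elzAux, Fml.sat, Fml.pev]
  | atom p args => exact hIA p args hN
  | neg F ih => simp [Fml.elzAux, Fml.sat, Fml.pev, ih hF hN]
  | and F G ihF ihG => simp [Fml.elzAux, Fml.sat, Fml.pev, ihF hF.1 hN.1, ihG hF.2 hN.2]
  | or F G ihF ihG => simp [Fml.elzAux, Fml.sat, Fml.pev, ihF hF.1 hN.1, ihG hF.2 hN.2]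
  | imp F G ihF ihG =>
    simp only [Fml.elzAux, Fml.sat, Fml.pev, ihF hF.1 hN.1, ihG hF.2 hN.2]
    cases F.pev A (!s) <;> simp
  | all | ex => exact hF.elim
  | chand | chor | chall | chex => cases s <;> simp [Fml.elzAux, Fml.sat, Fml.pev]

theorem Term.val_inj {N : ℕ} {t u : Term} (ht : t.bnd N) (hu : u.bnd N)
    (h : t.val (fun x => N + x) = u.val (fun x => N + x)) : t = u := by
  cases t <;> cases u <;> simp only [Term.val, Term.bnd, Term.var.injEq, Term.const.injEq,
    reduceCtorEq] at * <;> omega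

theorem Fml.exists_bnd (F : Fml) : ∃ N, F.bnd N := ⟨F.code + 1, Fml.bnd_of_code (Nat.lt_succ_self _)⟩

theorem Fml.stable_iff_taut {F : Fml} (hF : F.blindFree) : F.Stable ↔ F.Taut := by
  classical
  obtain ⟨N, hN⟩ := F.exists_bnd
  constructor
  · intro h A
    refine (Fml.sat_elz_iff (N := N) ?_ hF hN true).1
      (h (fun p l => ∃ args : List Term, (∀ t ∈ args, Term.bnd N t) ∧
        args.map (Term.val (fun x => N + x)) = l ∧ A p args = true) (fun x => N + x))
    intro p args hargs
    constructor
    · rintro ⟨args', hb, he, hA⟩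
      have : args' = args := by
        clear hA
        induction args' generalizing args with
        | nil => cases args <;> simp at he ⊢
        | cons a l ih =>
          cases args with
          | nil => simp at he
          | cons a' l' =>
            simp only [List.map_cons, List.cons.injEq] at he
            rw [Term.val_inj (hb a (by simp)) (hargs a' (by simp)) he.1,
              ih l' (fun t ht => hargs t (by simp [ht])) (fun t ht => hb t (by simp [ht])) he.2]
      rwa [← this]
    · intro hA
      exact ⟨args, hargs, rfl, hA⟩
  · intro h I v
    refine (Fml.sat_elz_iff (N := N) (A := fun p args => decide (I p (args.map (Term.val v))))
      ?_ hF hN true).2 (h _)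
    intro p args _
    simp

/-! ## Part 3 : renaming and substitution -/

def Term.ren (ρ κ : ℕ → ℕ) : Term → Term
  | .var x => .var (ρ x)
  | .const c => .const (κ c)

def Fml.ren (ρ κ : ℕ → ℕ) : Fml → Fml
  | .top => .top
  | .bot => .bot
  | .atom p args => .atom p (args.map (Term.ren ρ κ))
  | .neg F => .neg (F.ren ρ κ)
  | .and F G => .and (F.ren ρ κ) (G.ren ρ κ)
  | .or F G => .or (F.ren ρ κ) (G.ren ρ κ)
  | .imp F G => .imp (F.ren ρ κ) (G.ren ρ κ)
  | .all y F => .all (ρ y) (F.ren ρ κ)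
  | .ex y F => .ex (ρ y) (F.ren ρ κ)
  | .chand F G => .chand (F.ren ρ κ) (G.ren ρ κ)
  | .chor F G => .chor (F.ren ρ κ) (G.ren ρ κ)
  | .chall y F => .chall (ρ y) (F.ren ρ κ)
  | .chex y F => .chex (ρ y) (F.ren ρ κ)

section Ren

theorem Term.ren_subst {ρ κ : ℕ → ℕ} (hρ : Function.Injective ρ) (t : Term) (x : ℕ) (u : Term) :
    (t.subst x u).ren ρ κ = (t.ren ρ κ).subst (ρ x) (u.ren ρ κ) := by
  cases t with
  | var y =>
    by_cases h : y = x <;> simp [Term.subst, Term.ren, hρ.eq_iff, h]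
  | const c => rfl

theorem Fml.ren_subst {ρ κ : ℕ → ℕ} (hρ : Function.Injective ρ) (G : Fml) (x : ℕ) (u : Term) :
    (G.subst x u).ren ρ κ = (G.ren ρ κ).subst (ρ x) (u.ren ρ κ) := by
  induction G with
  | top | bot => rfl
  | atom p args => simp [Fml.subst, Fml.ren, Term.ren_subst hρ]
  | neg F ih => simp [Fml.subst, Fml.ren, ih]
  | and F G ihF ihG | or F G ihF ihG | imp F G ihF ihG | chand F G ihF ihG | chor F G ihF ihG =>
    simp [Fml.subst, Fml.ren, ihF, ihG]
  | all y F ih | ex y F ih | chall y F ih | chex y F ih =>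
    simp only [Fml.subst, Fml.ren, hρ.eq_iff]
    split <;> simp [Fml.ren, ih]

theorem var_mem_ren {ρ κ : ℕ → ℕ} (hρ : Function.Injective ρ) {args : List Term} {x : ℕ} :
    Term.var (ρ x) ∈ args.map (Term.ren ρ κ) ↔ Term.var x ∈ args := by
  simp only [List.mem_map]
  constructor
  · rintro ⟨t, ht, he⟩
    cases t with
    | var y =>
      simp only [Term.ren, Term.var.injEq, hρ.eq_iff] at he
      rwa [← he]
    | const c => simp [Term.ren] at he
  · intro h
    exact ⟨_, h, rfl⟩

theorem Fml.ren_freeVars {ρ κ : ℕ → ℕ} (hρ : Function.Injective ρ) {G : Fml} {x : ℕ} :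
    ρ x ∈ (G.ren ρ κ).freeVars ↔ x ∈ G.freeVars := by
  induction G with
  | top | bot => simp [Fml.ren, Fml.freeVars]
  | atom p args => simp only [Fml.ren, Fml.freeVars, mem_foldr_vars, var_mem_ren hρ]
  | neg F ih => exact ih
  | and F G ihF ihG | or F G ihF ihG | imp F G ihF ihG | chand F G ihF ihG | chor F G ihF ihG =>
    simp [Fml.ren, Fml.freeVars, ihF, ihG]
  | all y F ih | ex y F ih | chall y F ih | chex y F ih =>
    simp [Fml.ren, Fml.freeVars, ih, hρ.eq_iff]

theorem Fml.ren_vars {ρ κ : ℕ → ℕ} (hρ : Function.Injective ρ) {G : Fml} {x : ℕ} :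
    ρ x ∈ (G.ren ρ κ).vars ↔ x ∈ G.vars := by
  induction G with
  | top | bot => simp [Fml.ren, Fml.vars]
  | atom p args => simp only [Fml.ren, Fml.vars, mem_foldr_vars, var_mem_ren hρ]
  | neg F ih => exact ih
  | and F G ihF ihG | or F G ihF ihG | imp F G ihF ihG | chand F G ihF ihG | chor F G ihF ihG =>
    simp [Fml.ren, Fml.vars, ihF, ihG]
  | all y F ih | ex y F ih | chall y F ih | chex y F ih =>
    simp [Fml.ren, Fml.vars, ih, hρ.eq_iff]

theorem Fml.ren_capturesAt {ρ κ : ℕ → ℕ} (hρ : Function.Injective ρ) {G : Fml} {x v : ℕ} :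
    (G.ren ρ κ).capturesAt (ρ x) (ρ v) ↔ G.capturesAt x v := by
  induction G with
  | top | bot | atom => simp [Fml.ren, Fml.capturesAt]
  | neg F ih => exact ih
  | and F G ihF ihG | or F G ihF ihG | imp F G ihF ihG | chand F G ihF ihG | chor F G ihF ihG =>
    simp [Fml.ren, Fml.capturesAt, ihF, ihG]
  | all y F ih | ex y F ih | chall y F ih | chex y F ih =>
    simp [Fml.ren, Fml.capturesAt, ih, hρ.eq_iff, Fml.ren_freeVars hρ]

theorem OkSub.ren_iff {ρ κ : ℕ → ℕ} (hρ : Function.Injective ρ) {G : Fml} {x : ℕ} {t : Term} :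
    OkSub (G.ren ρ κ) (ρ x) (t.ren ρ κ) ↔ OkSub G x t := by
  cases t with
  | var v => simp [OkSub, Term.ren, Fml.ren_capturesAt hρ]
  | const c => simp [OkSub, Term.ren]

theorem Loc.ren {ρ κ : ℕ → ℕ} (hρ : Function.Injective ρ) {t s F H} (h : Loc t s F H) :
    Loc (t.ren ρ κ) s (F.ren ρ κ) (H.ren ρ κ) := by
  cases h with
  | chorL => exact .chorL _ _
  | chorR => exact .chorR _ _
  | chandL => exact .chandL _ _
  | chandR => exact .chandR _ _
  | chex x G h => rw [Fml.ren_subst hρ]; exact .chex _ _ ((OkSub.ren_iff hρ).2 h)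
  | chall x G h => rw [Fml.ren_subst hρ]; exact .chall _ _ ((OkSub.ren_iff hρ).2 h)

theorem Step.ren {ρ κ : ℕ → ℕ} (hρ : Function.Injective ρ) {t s F H} (h : Step t s F H) :
    Step (t.ren ρ κ) s (F.ren ρ κ) (H.ren ρ κ) := by
  induction h with
  | loc h => exact .loc (h.ren hρ)
  | neg _ ih => exact .neg ih
  | andL _ _ ih => exact .andL _ ih
  | andR _ _ ih => exact .andR _ ih
  | orL _ _ ih => exact .orL _ ih
  | orR _ _ ih => exact .orR _ ih
  | impL _ _ ih => exact .impL _ ih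
  | impR _ _ ih => exact .impR _ ih

theorem Step.of_ren {ρ κ : ℕ → ℕ} (hρ : Function.Injective ρ) {t s F H'} (h : Step (t.ren ρ κ) s (F.ren ρ κ) H') :
    ∃ H, Step t s F H ∧ H' = H.ren ρ κ := by
  induction F generalizing s H' with
  | top | bot | atom | all | ex => cases h with | loc h => cases h
  | neg F ih =>
    cases h with
    | loc h => cases h
    | neg h => obtain ⟨H, h1, rfl⟩ := ih h; exact ⟨_, .neg h1, rfl⟩
  | and F G ihF ihG =>
    cases h with
    | loc h => cases h
    | andL _ h => obtain ⟨H, h1, rfl⟩ := ihF h; exact ⟨_, .andL _ h1, rfl⟩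
    | andR _ h => obtain ⟨H, h1, rfl⟩ := ihG h; exact ⟨_, .andR _ h1, rfl⟩
  | or F G ihF ihG =>
    cases h with
    | loc h => cases h
    | orL _ h => obtain ⟨H, h1, rfl⟩ := ihF h; exact ⟨_, .orL _ h1, rfl⟩
    | orR _ h => obtain ⟨H, h1, rfl⟩ := ihG h; exact ⟨_, .orR _ h1, rfl⟩
  | imp F G ihF ihG =>
    cases h with
    | loc h => cases h
    | impL _ h => obtain ⟨H, h1, rfl⟩ := ihF h; exact ⟨_, .impL _ h1, rfl⟩
    | impR _ h => obtain ⟨H, h1, rfl⟩ := ihG h; exact ⟨_, .impR _ h1, rfl⟩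
  | chand F G =>
    cases h with
    | loc h => cases h with
      | chandL => exact ⟨_, .loc (.chandL _ _), rfl⟩
      | chandR => exact ⟨_, .loc (.chandR _ _), rfl⟩
  | chor F G =>
    cases h with
    | loc h => cases h with
      | chorL => exact ⟨_, .loc (.chorL _ _), rfl⟩
      | chorR => exact ⟨_, .loc (.chorR _ _), rfl⟩
  | chall x G =>
    cases h with
    | loc h => cases h with
      | chall _ _ h =>
        exact ⟨_, .loc (.chall _ _ ((OkSub.ren_iff hρ).1 h)), (Fml.ren_subst hρ _ _ _).symm⟩
  | chex x G =>
    cases h with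
    | loc h => cases h with
      | chex _ _ h =>
        exact ⟨_, .loc (.chex _ _ ((OkSub.ren_iff hρ).1 h)), (Fml.ren_subst hρ _ _ _).symm⟩

end Ren

theorem Fml.pev_ren {ρ κ : ℕ → ℕ} (A : ℕ → List Term → Bool) (F : Fml) (s : Bool) :
    (F.ren ρ κ).pev A s = F.pev (fun p args => A p (args.map (Term.ren ρ κ))) s := by
  induction F generalizing s with
  | neg F ih => simp [Fml.ren, Fml.pev, ih]
  | and F G ihF ihG | or F G ihF ihG | imp F G ihF ihG => simp [Fml.ren, Fml.pev, ihF, ihG]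
  | _ => rfl

theorem Fml.ren_eq_self {ρ κ : ℕ → ℕ} {N : ℕ} {F : Fml} (h1 : ∀ x ∈ F.vars, ρ x = x)
    (h2 : ∀ c < N, κ c = c) (hN : F.bnd N) : F.ren ρ κ = F := by
  induction F with
  | top | bot => rfl
  | atom p args =>
    simp only [Fml.ren, Fml.atom.injEq, true_and]
    conv_rhs => rw [← List.map_id args]
    apply List.map_congr_left
    intro t ht
    cases t with
    | var x => simp [Term.ren, h1 x (mem_foldr_vars.2 ht)]
    | const c => simp [Term.ren, h2 c (hN _ ht)]
  | neg F ih => simp [Fml.ren, ih h1 hN]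
  | and F G ihF ihG | or F G ihF ihG | imp F G ihF ihG | chand F G ihF ihG | chor F G ihF ihG =>
    simp only [Fml.vars, Finset.mem_union] at h1
    simp [Fml.ren, ihF (fun x hx => h1 x (.inl hx)) hN.1, ihG (fun x hx => h1 x (.inr hx)) hN.2]
  | all y F ih | ex y F ih | chall y F ih | chex y F ih =>
    simp only [Fml.vars, Finset.mem_insert] at h1
    simp [Fml.ren, h1 y (.inl rfl), ih (fun x hx => h1 x (.inr hx)) hN.2]

theorem Fml.blindFree_ren {ρ κ : ℕ → ℕ} {F : Fml} (h : F.blindFree) : (F.ren ρ κ).blindFree := by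
  induction F with
  | top | bot | atom => trivial
  | neg F ih => exact ih h
  | and F G ihF ihG | or F G ihF ihG | imp F G ihF ihG | chand F G ihF ihG | chor F G ihF ihG =>
    exact ⟨ihF h.1, ihG h.2⟩
  | all | ex => exact h.elim
  | chall y F ih | chex y F ih => exact ih h

theorem Fml.ren_replaceAt {ρ κ : ℕ → ℕ} (π : FPath) : ∀ {F Y H : Fml},
    F.replaceAt π Y = some H → (F.ren ρ κ).replaceAt π (Y.ren ρ κ) = some (H.ren ρ κ) := by
  induction π with
  | here =>
    intro F Y H h
    have : Y = H := by cases F <;> simpa [Fml.replaceAt] using h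
    subst this
    cases F <;> rfl
  | _ π ih =>
    intro F Y H h
    cases F <;> simp only [Fml.replaceAt, Option.map_eq_some_iff, reduceCtorEq] at h
    obtain ⟨F', h, rfl⟩ := h
    simp [Fml.replaceAt, Fml.ren, ih h]

/-! Substitution of a constant for a variable. -/

theorem Fml.freeVars_subset_vars (F : Fml) : F.freeVars ⊆ F.vars := by
  induction F with
  | top | bot | atom => exact subset_rfl
  | neg F ih => exact ih
  | and F G ihF ihG | or F G ihF ihG | imp F G ihF ihG | chand F G ihF ihG | chor F G ihF ihG =>
    exact Finset.union_subset_union ihF ihG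
  | all y F ih | ex y F ih | chall y F ih | chex y F ih =>
    intro z hz
    simp only [Fml.freeVars, Finset.mem_erase] at hz
    simp [Fml.vars, ih hz.2]

theorem Fml.subst_eq_self {F : Fml} {x : ℕ} {u : Term} (h : x ∉ F.freeVars) : F.subst x u = F := by
  induction F with
  | top | bot => rfl
  | atom p args =>
    simp only [Fml.subst, Fml.atom.injEq, true_and]
    conv_rhs => rw [← List.map_id args]
    apply List.map_congr_left
    intro t ht
    cases t with
    | var y =>
      simp only [Term.subst, id]
      rw [if_neg]
      rintro rfl
      exact h (mem_foldr_vars.2 ht)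
    | const c => rfl
  | neg F ih => simp only [Fml.subst, ih h]
  | and F G ihF ihG | or F G ihF ihG | imp F G ihF ihG | chand F G ihF ihG | chor F G ihF ihG =>
    simp only [Fml.freeVars, Finset.mem_union, not_or] at h
    simp only [Fml.subst, ihF h.1, ihG h.2]
  | all y F ih | ex y F ih | chall y F ih | chex y F ih =>
    simp only [Fml.freeVars, Finset.mem_erase, not_and] at h
    simp only [Fml.subst]
    split
    · rfl
    · rename_i hne
      rw [ih (h (fun e => hne e.symm))]

theorem Fml.subst_subst_same (G : Fml) (x : ℕ) (t u : Term) :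
    (G.subst x t).subst x u = G.subst x (t.subst x u) := by
  induction G with
  | top | bot => rfl
  | atom p args =>
    simp only [Fml.subst, List.map_map, Fml.atom.injEq, true_and]
    apply List.map_congr_left
    intro a _
    cases a with
    | var y => by_cases h : y = x <;> simp [Term.subst, h]
    | const c => rfl
  | neg F ih => simp [Fml.subst, ih]
  | and F G ihF ihG | or F G ihF ihG | imp F G ihF ihG | chand F G ihF ihG | chor F G ihF ihG =>
    simp [Fml.subst, ihF, ihG]
  | all y F ih | ex y F ih | chall y F ih | chex y F ih =>
    simp only [Fml.subst]
    split <;> simp [Fml.subst, *]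

theorem Fml.subst_subst_comm (G : Fml) {x v c : ℕ} {t : Term} (hxv : x ≠ v) (h : OkSub G x t) :
    (G.subst x t).subst v (.const c) = (G.subst v (.const c)).subst x (t.subst v (.const c)) := by
  induction G with
  | top | bot => rfl
  | atom p args =>
    simp only [Fml.subst, List.map_map, Fml.atom.injEq, true_and]
    apply List.map_congr_left
    intro a _
    cases a with
    | var y =>
      simp only [Function.comp, Term.subst]
      by_cases h1 : y = x
      · subst h1; simp [hxv, Term.subst]
      · by_cases h2 : y = v
        · subst h2; simp [h1, Term.subst]
        · simp [h1, h2, Term.subst]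
    | const c => rfl
  | neg F ih => simp only [Fml.subst, ih h]
  | and F G ihF ihG | or F G ihF ihG | imp F G ihF ihG | chand F G ihF ihG | chor F G ihF ihG =>
    simp only [Fml.subst, ihF (fun w hw hc => h w hw (.inl hc)),
      ihG (fun w hw hc => h w hw (.inr hc))]
  | all y F ih | ex y F ih | chall y F ih | chex y F ih =>
    by_cases h1 : y = x
    · subst h1
      simp [Fml.subst, hxv]
    · have hF : OkSub F x t := fun w hw hc => h w hw ⟨fun e => h1 e.symm, .inr hc⟩
      by_cases h2 : y = v
      · subst h2
        simp only [Fml.subst, h1, if_true, if_false]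
        congr 1
        by_cases h3 : t = .var y
        · have hx : x ∉ F.freeVars := fun hx => h y h3 ⟨hxv, .inl ⟨rfl, hx⟩⟩
          rw [Fml.subst_eq_self hx, Fml.subst_eq_self hx]
        · have : t.subst y (.const c) = t := by
            cases t with
            | var z =>
              simp only [Term.subst]
              rw [if_neg]
              rintro rfl
              exact h3 rfl
            | const => rfl
          rw [this]
      · simp only [Fml.subst, h1, h2, if_false, ih hF]

theorem Fml.mem_freeVars_subst {G : Fml} {x v c : ℕ} (hxv : x ≠ v) :
    x ∈ (G.subst v (.const c)).freeVars ↔ x ∈ G.freeVars := by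
  induction G with
  | top | bot => rfl
  | atom p args =>
    simp only [Fml.subst, Fml.freeVars, mem_foldr_vars, List.mem_map]
    constructor
    · rintro ⟨t, ht, he⟩
      cases t with
      | var y =>
        simp only [Term.subst] at he
        split at he
        · simp at he
        · rwa [← he]
      | const c => simp [Term.subst] at he
    · intro h
      exact ⟨_, h, by simp [Term.subst, hxv]⟩
  | neg F ih => exact ih
  | and F G ihF ihG | or F G ihF ihG | imp F G ihF ihG | chand F G ihF ihG | chor F G ihF ihG =>
    simp [Fml.subst, Fml.freeVars, ihF, ihG]
  | all y F ih | ex y F ih | chall y F ih | chex y F ih =>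
    simp only [Fml.subst]
    split <;> simp [Fml.freeVars, ih]

theorem Fml.capturesAt_subst {G : Fml} {x v c w : ℕ} (hxv : x ≠ v) :
    (G.subst v (.const c)).capturesAt x w ↔ G.capturesAt x w := by
  induction G with
  | top | bot | atom => rfl
  | neg F ih => exact ih
  | and F G ihF ihG | or F G ihF ihG | imp F G ihF ihG | chand F G ihF ihG | chor F G ihF ihG =>
    simp [Fml.subst, Fml.capturesAt, ihF, ihG]
  | all y F ih | ex y F ih | chall y F ih | chex y F ih =>
    simp only [Fml.subst]
    split <;> simp [Fml.capturesAt, ih, Fml.mem_freeVars_subst hxv]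

theorem OkSub.const (G : Fml) (x c : ℕ) : OkSub G x (.const c) := fun _ h => by simp at h

theorem OkSub.subst_same {G : Fml} {v c : ℕ} {t : Term} (h : OkSub G v t) :
    OkSub G v (t.subst v (.const c)) := by
  cases t with
  | var w =>
    simp only [Term.subst]; split
    · exact OkSub.const _ _ _
    · exact h
  | const d => exact h

theorem OkSub.subst_ne {G : Fml} {x v c : ℕ} {t : Term} (hxv : x ≠ v) (h : OkSub G x t) :
    OkSub (G.subst v (.const c)) x (t.subst v (.const c)) := by
  cases t with
  | var w =>
    simp only [Term.subst]; split
    · exact OkSub.const _ _ _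
    · intro u hu hc
      exact h u hu ((Fml.capturesAt_subst hxv).1 hc)
  | const d => exact OkSub.const _ _ _

theorem Loc.subst {t s F H} (v c : ℕ) (h : Loc t s F H) :
    Loc (t.subst v (.const c)) s (F.subst v (.const c)) (H.subst v (.const c)) := by
  cases h with
  | chorL => exact .chorL _ _
  | chorR => exact .chorR _ _
  | chandL => exact .chandL _ _
  | chandR => exact .chandR _ _
  | chex x G h =>
    by_cases hx : x = v
    · subst hx
      rw [Fml.subst_subst_same]
      simp only [Fml.subst, if_true]
      exact .chex _ _ h.subst_same
    · rw [Fml.subst_subst_comm _ hx h]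
      simp only [Fml.subst, hx, if_false]
      exact .chex _ _ (h.subst_ne hx)
  | chall x G h =>
    by_cases hx : x = v
    · subst hx
      rw [Fml.subst_subst_same]
      simp only [Fml.subst, if_true]
      exact .chall _ _ h.subst_same
    · rw [Fml.subst_subst_comm _ hx h]
      simp only [Fml.subst, hx, if_false]
      exact .chall _ _ (h.subst_ne hx)

theorem Step.subst {t s F H} (v c : ℕ) (h : Step t s F H) :
    Step (t.subst v (.const c)) s (F.subst v (.const c)) (H.subst v (.const c)) := by
  induction h with
  | loc h => exact .loc (h.subst v c)
  | neg _ ih => exact .neg ih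
  | andL _ _ ih => exact .andL _ ih
  | andR _ _ ih => exact .andR _ ih
  | orL _ _ ih => exact .orL _ ih
  | orR _ _ ih => exact .orR _ ih
  | impL _ _ ih => exact .impL _ ih
  | impR _ _ ih => exact .impR _ ih

theorem Step.of_subst {y v c : ℕ} {s F H'} (hy : y ≠ v) (hF : y ∉ F.vars)
    (h : Step (.var y) s (F.subst v (.const c)) H') :
    ∃ H, Step (.var y) s F H ∧ H' = H.subst v (.const c) := by
  have hyt : (Term.var y).subst v (.const c) = .var y := by simp [Term.subst, hy]
  induction F generalizing s H' with
  | top | bot | atom => cases h with | loc h => cases h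
  | all | ex =>
    simp only [Fml.subst] at h
    split at h <;> cases h with | loc h => cases h
  | neg F ih =>
    cases h with
    | loc h => cases h
    | neg h => obtain ⟨H, h1, rfl⟩ := ih hF h; exact ⟨_, .neg h1, rfl⟩
  | and F G ihF ihG =>
    simp only [Fml.vars, Finset.mem_union, not_or] at hF
    cases h with
    | loc h => cases h
    | andL _ h => obtain ⟨H, h1, rfl⟩ := ihF hF.1 h; exact ⟨_, .andL _ h1, rfl⟩
    | andR _ h => obtain ⟨H, h1, rfl⟩ := ihG hF.2 h; exact ⟨_, .andR _ h1, rfl⟩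
  | or F G ihF ihG =>
    simp only [Fml.vars, Finset.mem_union, not_or] at hF
    cases h with
    | loc h => cases h
    | orL _ h => obtain ⟨H, h1, rfl⟩ := ihF hF.1 h; exact ⟨_, .orL _ h1, rfl⟩
    | orR _ h => obtain ⟨H, h1, rfl⟩ := ihG hF.2 h; exact ⟨_, .orR _ h1, rfl⟩
  | imp F G ihF ihG =>
    simp only [Fml.vars, Finset.mem_union, not_or] at hF
    cases h with
    | loc h => cases h
    | impL _ h => obtain ⟨H, h1, rfl⟩ := ihF hF.1 h; exact ⟨_, .impL _ h1, rfl⟩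
    | impR _ h => obtain ⟨H, h1, rfl⟩ := ihG hF.2 h; exact ⟨_, .impR _ h1, rfl⟩
  | chand F G =>
    cases h with
    | loc h => cases h with
      | chandL => exact ⟨_, .loc (.chandL _ _), rfl⟩
      | chandR => exact ⟨_, .loc (.chandR _ _), rfl⟩
  | chor F G =>
    cases h with
    | loc h => cases h with
      | chorL => exact ⟨_, .loc (.chorL _ _), rfl⟩
      | chorR => exact ⟨_, .loc (.chorR _ _), rfl⟩
  | chall x G =>
    have hok : OkSub G x (.var y) := by
      intro w hw hc
      cases hw
      exact hF (by simp [Fml.vars, Fml.capturesAt_mem_vars hc])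
    by_cases hx : x = v
    · subst hx
      simp only [Fml.subst, if_true] at h
      cases h with
      | loc h => cases h with
        | chall _ _ h =>
          exact ⟨_, .loc (.chall _ _ hok), by rw [Fml.subst_subst_same, hyt]⟩
    · simp only [Fml.subst, hx, if_false] at h
      cases h with
      | loc h => cases h with
        | chall _ _ h =>
          exact ⟨_, .loc (.chall _ _ hok), by rw [Fml.subst_subst_comm _ hx hok, hyt]⟩
  | chex x G =>
    have hok : OkSub G x (.var y) := by
      intro w hw hc
      cases hw
      exact hF (by simp [Fml.vars, Fml.capturesAt_mem_vars hc])
    by_cases hx : x = v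
    · subst hx
      simp only [Fml.subst, if_true] at h
      cases h with
      | loc h => cases h with
        | chex _ _ h =>
          exact ⟨_, .loc (.chex _ _ hok), by rw [Fml.subst_subst_same, hyt]⟩
    · simp only [Fml.subst, hx, if_false] at h
      cases h with
      | loc h => cases h with
        | chex _ _ h =>
          exact ⟨_, .loc (.chex _ _ hok), by rw [Fml.subst_subst_comm _ hx hok, hyt]⟩

theorem Fml.pev_subst {v : ℕ} {u : Term} (A : ℕ → List Term → Bool) (F : Fml) (s : Bool) :
    (F.subst v u).pev A s = F.pev (fun p args => A p (args.map (fun t => t.subst v u))) s := by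
  induction F generalizing s with
  | neg F ih => simp [Fml.subst, Fml.pev, ih]
  | and F G ihF ihG | or F G ihF ihG | imp F G ihF ihG => simp [Fml.subst, Fml.pev, ihF, ihG]
  | all | ex | chall | chex => simp only [Fml.subst]; split <;> rfl
  | _ => rfl

theorem Fml.vars_subst_const {F : Fml} {v c : ℕ} : (F.subst v (.const c)).vars ⊆ F.vars := by
  induction F with
  | top | bot => exact subset_rfl
  | atom p args =>
    intro x
    simp only [Fml.subst, Fml.vars, mem_foldr_vars, List.mem_map]
    rintro ⟨t, ht, he⟩
    cases t with
    | var y =>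
      simp only [Term.subst] at he
      split at he
      · simp at he
      · rwa [← he]
    | const c => simp [Term.subst] at he
  | neg F ih => exact ih
  | and F G ihF ihG | or F G ihF ihG | imp F G ihF ihG | chand F G ihF ihG | chor F G ihF ihG =>
    exact Finset.union_subset_union ihF ihG
  | all y F ih | ex y F ih | chall y F ih | chex y F ih =>
    simp only [Fml.subst]; split
    · exact subset_rfl
    · exact Finset.insert_subset_insert _ ih

/-! ## Part 4 : an equivalent inductive presentation of provability -/

inductive Prov2 : Fml → Prop
  | A (F : Fml) (hT : F.Taut) (y : ℕ) (hy : y ∉ F.vars)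
      (h : ∀ H, Step (.var y) false F H → Prov2 H) : Prov2 F
  | B (F H : Fml) (t : Term) (hs : Step t true F H) (h : Prov2 H) : Prov2 F

theorem Prov2.ren {ρ κ : ℕ → ℕ} (hρ : Function.Injective ρ) {F : Fml} (h : Prov2 F) :
    Prov2 (F.ren ρ κ) := by
  induction h with
  | A F hT y hy _ ih =>
    refine .A _ (fun A => ?_) (ρ y) (fun h => hy ((Fml.ren_vars hρ).1 h)) ?_
    · rw [Fml.pev_ren]; exact hT _
    · intro H' hH'
      obtain ⟨H, h1, rfl⟩ := Step.of_ren (t := .var y) hρ hH'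
      exact ih H h1
  | B F H t hs _ ih => exact .B _ _ _ (hs.ren hρ) ih

theorem Prov2.subst (v c : ℕ) {F : Fml} (h : Prov2 F) : Prov2 (F.subst v (.const c)) := by
  induction h with
  | A F hT y hy h ih =>
    by_cases hv : v ∈ F.vars
    · have hyv : y ≠ v := by rintro rfl; exact hy hv
      refine .A _ (fun A => ?_) y (fun h => hy (Fml.vars_subst_const h)) ?_
      · rw [Fml.pev_subst]; exact hT _
      · intro H' hH'
        obtain ⟨H, h1, rfl⟩ := Step.of_subst hyv hy hH'
        exact ih H h1
    · rw [Fml.subst_eq_self (fun h => hv (Fml.freeVars_subset_vars _ h))]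
      exact .A F hT y hy h
  | B F H t hs _ ih => exact .B _ _ _ (hs.subst v c) ih

theorem Fml.swap_eq_self {a b : ℕ} {F : Fml} (ha : a ∉ F.vars) (hb : b ∉ F.vars) :
    F.ren (Equiv.swap a b) id = F := by
  obtain ⟨N, hN⟩ := F.exists_bnd
  refine Fml.ren_eq_self (fun x hx => Equiv.swap_apply_of_ne_of_ne ?_ ?_) (fun _ _ => rfl) hN
  · rintro rfl; exact ha hx
  · rintro rfl; exact hb hx

theorem Fml.fresh_code (F : Fml) : F.code + 1 ∉ F.vars := fun h =>
  absurd (Fml.bnd_vars (Fml.bnd_of_code (N := F.code + 1) (Nat.lt_succ_self _)) h) (lt_irrefl _)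

theorem Fml.not_mem_of_bnd (F : Fml) {x : ℕ} (h : F.code + 1 ≤ x) : x ∉ F.vars := fun h' =>
  absurd (Fml.bnd_vars (Fml.bnd_of_code (N := F.code + 1) (Nat.lt_succ_self _)) h') (by omega)

/-- Changing the eigenvariable of a step. -/
theorem Step.swap {s F H} {a b : ℕ} (ha : a ∉ F.vars) (hb : b ∉ F.vars)
    (h : Step (.var a) s F H) : Step (.var b) s F (H.ren (Equiv.swap a b) id) := by
  have := h.ren (ρ := Equiv.swap a b) (κ := id) (Equiv.injective _)
  rwa [Fml.swap_eq_self ha hb, show (Term.var a).ren (Equiv.swap a b) id = .var b by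
    simp [Term.ren]] at this

theorem Fml.ren_swap_swap (a b : ℕ) (F : Fml) :
    (F.ren (Equiv.swap a b) id).ren (Equiv.swap a b) id = F := by
  have key : ∀ t : Term, (t.ren (Equiv.swap a b) id).ren (Equiv.swap a b) id = t := by
    intro t; cases t <;> simp [Term.ren]
  induction F with
  | top | bot => rfl
  | atom p args => simp [Fml.ren, Function.comp_def, key]
  | neg F ih => simp [Fml.ren, ih]
  | and F G ihF ihG | or F G ihF ihG | imp F G ihF ihG | chand F G ihF ihG | chor F G ihF ihG =>
    simp [Fml.ren, ihF, ihG]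
  | all y F ih | ex y F ih | chall y F ih | chex y F ih => simp [Fml.ren, ih]

theorem Prov2.of_swap {a b : ℕ} {F : Fml} (h : Prov2 (F.ren (Equiv.swap a b) id)) : Prov2 F := by
  have := h.ren (ρ := Equiv.swap a b) (κ := id) (Equiv.injective _)
  rwa [Fml.ren_swap_swap] at this

theorem Prov.toProv2 {F : Fml} (h : Prov F) : F.blindFree → Prov2 F := by
  induction h with
  | ruleA F hst ych hfresh hcon hqu ih1 ih2 =>
    intro hF
    refine .A F ((Fml.stable_iff_taut hF).1 hst) (F.code + 1) F.fresh_code ?_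
    intro H hH
    have hbH := hH.blindFree hF
    obtain ⟨π, r, X, Y, h1, h2, h3⟩ := hH.path
    have hX := Fml.subAt_vars _ h1
    generalize he : (r == false) = e at h2
    cases h2 with
    | chorL A B =>
      have : r = false := by simpa using he
      subst this
      exact ih1 π _ _ _ (.inr h1) _ (.inl rfl) H h3 hbH
    | chorR A B =>
      have : r = false := by simpa using he
      subst this
      exact ih1 π _ _ _ (.inr h1) _ (.inr rfl) H h3 hbH
    | chandL A B =>
      have : r = true := by simpa using he
      subst this
      exact ih1 π _ _ _ (.inl h1) _ (.inl rfl) H h3 hbH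
    | chandR A B =>
      have : r = true := by simpa using he
      subst this
      exact ih1 π _ _ _ (.inl h1) _ (.inr rfl) H h3 hbH
    | chex x G hok =>
      have : r = false := by simpa using he
      subst this
      have h4 := Fml.ren_replaceAt (ρ := Equiv.swap (F.code + 1) (ych π)) (κ := id) π h3
      have h5 : (Fml.chex x G).ren (Equiv.swap (F.code + 1) (ych π)) id = .chex x G :=
        Fml.swap_eq_self (fun h => F.fresh_code (hX h)) (fun h => hfresh π (hX h))
      simp only [Fml.ren, Fml.chex.injEq] at h5
      rw [Fml.swap_eq_self F.fresh_code (hfresh π), Fml.ren_subst (Equiv.injective _), h5.1, h5.2,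
        show (Term.var (F.code + 1)).ren (Equiv.swap (F.code + 1) (ych π)) id = .var (ych π) by
          simp [Term.ren]] at h4
      exact (ih2 π _ _ _ (.inr h1) _ h4 (Fml.blindFree_ren hbH)).of_swap
    | chall x G hok =>
      have : r = true := by simpa using he
      subst this
      have h4 := Fml.ren_replaceAt (ρ := Equiv.swap (F.code + 1) (ych π)) (κ := id) π h3
      have h5 : (Fml.chall x G).ren (Equiv.swap (F.code + 1) (ych π)) id = .chall x G :=
        Fml.swap_eq_self (fun h => F.fresh_code (hX h)) (fun h => hfresh π (hX h))
      simp only [Fml.ren, Fml.chall.injEq] at h5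
      rw [Fml.swap_eq_self F.fresh_code (hfresh π), Fml.ren_subst (Equiv.injective _), h5.1, h5.2,
        show (Term.var (F.code + 1)).ren (Equiv.swap (F.code + 1) (ych π)) id = .var (ych π) by
          simp [Term.ren]] at h4
      exact (ih2 π _ _ _ (.inl h1) _ h4 (Fml.blindFree_ren hbH)).of_swap
  | ruleB1 F F' π b G₁ G₂ G hocc hG hrep _ ih =>
    intro hF
    have hs : Step (.const 0) true F F' := by
      rcases hocc with h | h
      · refine Step.of_path π hF h (Y := G) ?_ hrep
        rcases hG with rfl | rfl
        · exact .chandL _ _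
        · exact .chandR _ _
      · refine Step.of_path π hF h (Y := G) ?_ hrep
        rcases hG with rfl | rfl
        · exact .chorL _ _
        · exact .chorR _ _
    exact .B _ _ _ hs (ih (hs.blindFree hF))
  | ruleB2 F F' π b x G t hocc hside hrep _ ih =>
    intro hF
    have hok : OkSub G x t := fun v hv => (hside v hv).2
    have hs : Step t true F F' := by
      rcases hocc with h | h
      · exact Step.of_path π hF h (.chall _ _ hok) hrep
      · exact Step.of_path π hF h (.chex _ _ hok) hrep
    exact .B _ _ _ hs (ih (hs.blindFree hF))

theorem Prov2.toProv {F : Fml} (h : Prov2 F) : F.blindFree → Prov F := by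
  induction h with
  | A F hT y hy _ ih =>
    intro hF
    refine .ruleA F ((Fml.stable_iff_taut hF).2 hT) (fun _ => y) (fun _ => hy) ?_ ?_
    · intro π b G₁ G₂ hocc G hG H hrep
      have hs : Step (.var y) false F H := by
        rcases hocc with h | h
        · refine Step.of_path π hF h (Y := G) ?_ hrep
          rcases hG with rfl | rfl
          · exact .chandL _ _
          · exact .chandR _ _
        · refine Step.of_path π hF h (Y := G) ?_ hrep
          rcases hG with rfl | rfl
          · exact .chorL _ _
          · exact .chorR _ _
      exact ih H hs (hs.blindFree hF)
    · intro π b x G hocc H hrep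
      have hok : ∀ X : Fml, X.vars ⊆ F.vars → OkSub X x (.var y) := by
        intro X hX v hv hc
        cases hv
        exact hy (hX (Fml.capturesAt_mem_vars hc))
      have hs : Step (.var y) false F H := by
        rcases hocc with h | h
        · exact Step.of_path π hF h (.chall _ _
            (hok _ ((Finset.subset_insert _ _).trans (Fml.subAt_vars _ h)))) hrep
        · exact Step.of_path π hF h (.chex _ _
            (hok _ ((Finset.subset_insert _ _).trans (Fml.subAt_vars _ h)))) hrep
      exact ih H hs (hs.blindFree hF)
  | B F H t hs _ ih =>
    intro hF
    have hbH := hs.blindFree hF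
    obtain ⟨π, r, X, Y, h1, h2, h3⟩ := hs.path
    generalize he : (r == true) = e at h2
    cases h2 with
    | chorL A B =>
      have : r = true := by simpa using he
      subst this
      exact .ruleB1 F H π _ _ _ _ (.inr h1) (.inl rfl) h3 (ih hbH)
    | chorR A B =>
      have : r = true := by simpa using he
      subst this
      exact .ruleB1 F H π _ _ _ _ (.inr h1) (.inr rfl) h3 (ih hbH)
    | chandL A B =>
      have : r = false := by simpa using he
      subst this
      exact .ruleB1 F H π _ _ _ _ (.inl h1) (.inl rfl) h3 (ih hbH)
    | chandR A B =>
      have : r = false := by simpa using he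
      subst this
      exact .ruleB1 F H π _ _ _ _ (.inl h1) (.inr rfl) h3 (ih hbH)
    | chex x G hok =>
      have : r = true := by simpa using he
      subst this
      exact .ruleB2 F H π _ _ _ t (.inr h1) (fun v hv => ⟨by simp, hok v hv⟩) h3 (ih hbH)
    | chall x G hok =>
      have : r = false := by simpa using he
      subst this
      exact .ruleB2 F H π _ _ _ t (.inl h1) (fun v hv => ⟨by simp, hok v hv⟩) h3 (ih hbH)

/-- The finitary characterization of provability used by the algorithm. -/
theorem Prov2.finitary {F : Fml} :
    Prov2 F ↔ (∃ t : Term, t.code < 2 * F.code + 4 ∧ ∃ H, Step t true F H ∧ Prov2 H) ∨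
      (F.Taut ∧ ∀ H, Step (.var (F.code + 1)) false F H → Prov2 H) := by
  have hN : F.bnd (F.code + 1) := Fml.bnd_of_code (Nat.lt_succ_self _)
  constructor
  · intro h
    cases h with
    | A _ hT y hy h =>
      refine .inr ⟨hT, fun H hH => ?_⟩
      exact (h _ (hH.swap F.fresh_code hy)).of_swap
    | B _ H t hs h =>
      left
      by_cases ht : t.code < 2 * F.code + 4
      · exact ⟨t, ht, H, hs, h⟩
      · cases t with
        | var v =>
          simp only [Term.code] at ht
          have hv : v ∉ F.vars := F.not_mem_of_bnd (by omega)
          have hs' := hs.subst v (F.code + 1)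
          rw [Fml.subst_eq_self (fun h => hv (Fml.freeVars_subset_vars _ h))] at hs'
          refine ⟨_, ?_, _, hs', h.subst _ _⟩
          simp [Term.subst, Term.code]; omega
        | const c =>
          simp only [Term.code] at ht
          have hs' := hs.ren (ρ := id) (κ := fun d => if d = c then F.code + 1 else d)
            Function.injective_id
          have he : F.ren id (fun d => if d = c then F.code + 1 else d) = F :=
            Fml.ren_eq_self (N := F.code + 1) (fun _ _ => rfl)
              (fun d hd => if_neg (by omega)) hN
          rw [he] at hs'
          refine ⟨_, ?_, _, hs', h.ren Function.injective_id⟩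
          simp [Term.ren, Term.code]; omega
  · rintro (⟨t, -, H, hs, h⟩ | ⟨hT, h⟩)
    · exact .B _ _ _ hs h
    · exact .A _ hT _ F.fresh_code h

/-! ## Part 5 : primitive recursive functions in composed form -/

section PR
variable {α β σ : Type} [Primcodable α] [Primcodable β] [Primcodable σ]

theorem pr_fst {f : α → β × σ} (hf : Primrec f) : Primrec fun a => (f a).1 := Primrec.fst.comp hf
theorem pr_snd {f : α → β × σ} (hf : Primrec f) : Primrec fun a => (f a).2 := Primrec.snd.comp hf
theorem pr_pair {f : α → β} {g : α → σ} (hf : Primrec f) (hg : Primrec g) :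
    Primrec fun a => (f a, g a) := Primrec.pair hf hg
theorem pr_npair {f g : α → ℕ} (hf : Primrec f) (hg : Primrec g) :
    Primrec fun a => Nat.pair (f a) (g a) := Primrec₂.natPair.comp hf hg
theorem pr_unpair {f : α → ℕ} (hf : Primrec f) :
    Primrec fun a => Nat.unpair (f a) := Primrec.unpair.comp hf
theorem pr_beq {f g : α → ℕ} (hf : Primrec f) (hg : Primrec g) :
    Primrec fun a => (f a == g a) := Primrec.beq.comp hf hg
theorem pr_add {f g : α → ℕ} (hf : Primrec f) (hg : Primrec g) :
    Primrec fun a => f a + g a := Primrec.nat_add.comp hf hg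
theorem pr_mul {f g : α → ℕ} (hf : Primrec f) (hg : Primrec g) :
    Primrec fun a => f a * g a := Primrec.nat_mul.comp hf hg
theorem pr_div {f g : α → ℕ} (hf : Primrec f) (hg : Primrec g) :
    Primrec fun a => f a / g a := Primrec.nat_div.comp hf hg
theorem pr_mod {f g : α → ℕ} (hf : Primrec f) (hg : Primrec g) :
    Primrec fun a => f a % g a := Primrec.nat_mod.comp hf hg
theorem pr_two_pow {f : α → ℕ} (hf : Primrec f) : Primrec fun a => 2 ^ f a := by
  have : Primrec fun n : ℕ => 2 ^ n := by
    refine (Primrec.nat_rec₁ (f := fun _ r => 2 * r) 1 ?_).of_eq ?_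
    · exact (pr_mul (Primrec.const 2) Primrec.snd)
    · intro n
      induction n with
      | zero => rfl
      | succ n ih => simp only [pow_succ, ← ih]; ring
  exact this.comp hf
theorem pr_cond {c : α → Bool} {f g : α → σ} (hc : Primrec c) (hf : Primrec f) (hg : Primrec g) :
    Primrec fun a => bif c a then f a else g a := Primrec.cond hc hf hg
theorem pr_and {f g : α → Bool} (hf : Primrec f) (hg : Primrec g) :
    Primrec fun a => (f a && g a) := Primrec.and.comp hf hg
theorem pr_or {f g : α → Bool} (hf : Primrec f) (hg : Primrec g) :
    Primrec fun a => (f a || g a) := Primrec.or.comp hf hg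
theorem pr_not {f : α → Bool} (hf : Primrec f) : Primrec fun a => !(f a) := Primrec.not.comp hf
theorem pr_cons {f : α → β} {g : α → List β} (hf : Primrec f) (hg : Primrec g) :
    Primrec fun a => f a :: g a := Primrec.list_cons.comp hf hg
theorem pr_append {f g : α → List β} (hf : Primrec f) (hg : Primrec g) :
    Primrec fun a => f a ++ g a := Primrec.list_append.comp hf hg
theorem pr_range {f : α → ℕ} (hf : Primrec f) : Primrec fun a => List.range (f a) :=
  Primrec.list_range.comp hf
theorem pr_map {f : α → List β} {g : α → β → σ} (hf : Primrec f)
    (hg : Primrec fun p : α × β => g p.1 p.2) : Primrec fun a => (f a).map (g a) :=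
  Primrec.list_map hf hg
theorem pr_flatMap {f : α → List β} {g : α → β → List σ} (hf : Primrec f)
    (hg : Primrec fun p : α × β => g p.1 p.2) : Primrec fun a => (f a).flatMap (g a) :=
  Primrec.list_flatMap hf hg
theorem pr_any {f : α → List β} {g : α → β → Bool} (hf : Primrec f)
    (hg : Primrec fun p : α × β => g p.1 p.2) : Primrec fun a => (f a).any (g a) := by
  refine (Primrec.list_foldr (h := fun a p => (g a p.1 || p.2)) hf (Primrec.const false) ?_).of_eq ?_
  · exact pr_or (hg.comp (pr_pair Primrec.fst (pr_fst Primrec.snd))) (pr_snd Primrec.snd)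
  · intro a
    induction f a with
    | nil => rfl
    | cons b l ih => simp only [List.foldr_cons, List.any_cons, ih]
theorem pr_all {f : α → List β} {g : α → β → Bool} (hf : Primrec f)
    (hg : Primrec fun p : α × β => g p.1 p.2) : Primrec fun a => (f a).all (g a) := by
  refine (Primrec.list_foldr (h := fun a p => (g a p.1 && p.2)) hf (Primrec.const true) ?_).of_eq ?_
  · exact pr_and (hg.comp (pr_pair Primrec.fst (pr_fst Primrec.snd))) (pr_snd Primrec.snd)
  · intro a
    induction f a with
    | nil => rfl
    | cons b l ih => simp only [List.foldr_cons, List.all_cons, ih]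
theorem pr_filter {f : α → List β} {g : α → β → Bool} (hf : Primrec f)
    (hg : Primrec fun p : α × β => g p.1 p.2) : Primrec fun a => (f a).filter (g a) := by
  refine (Primrec.list_foldr (h := fun a p => bif g a p.1 then p.1 :: p.2 else p.2) hf
    (Primrec.const []) ?_).of_eq ?_
  · exact pr_cond (hg.comp (pr_pair Primrec.fst (pr_fst Primrec.snd)))
      (pr_cons (pr_fst Primrec.snd) (pr_snd Primrec.snd)) (pr_snd Primrec.snd)
  · intro a
    induction f a with
    | nil => rfl
    | cons b l ih =>
      simp only [List.foldr_cons, List.filter_cons, ih]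
      cases g a b <;> rfl

/-- Decoding a list of naturals. -/
def dl (n : ℕ) : List ℕ := (Encodable.decode (α := List ℕ) n).getD []

theorem pr_dl {f : α → ℕ} (hf : Primrec f) : Primrec fun a => dl (f a) :=
  Primrec.option_getD.comp (Primrec.decode.comp hf) (Primrec.const [])
theorem pr_encode {f : α → List ℕ} (hf : Primrec f) : Primrec fun a => Encodable.encode (f a) :=
  Primrec.encode.comp hf

theorem listCode_eq (l : List ℕ) : listCode l = Encodable.encode l := by
  induction l with
  | nil => rfl
  | cons a l ih => simp [listCode, ih]

@[simp] theorem dl_listCode (l : List ℕ) : dl (listCode l) = l := by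
  simp [dl, listCode_eq]

/-- Structural recursion on codes. -/
def cfold (d : σ) (g : α → ℕ → σ → σ → σ → σ) (a : α) (n : ℕ) : σ :=
  g a n (if _h : n.unpair.2 < n then cfold d g a n.unpair.2 else d)
    (if _h : n.unpair.2.unpair.1 < n then cfold d g a n.unpair.2.unpair.1 else d)
    (if _h : n.unpair.2.unpair.2 < n then cfold d g a n.unpair.2.unpair.2 else d)
termination_by n

theorem pr_cfold (d : σ) {g : α → ℕ → σ → σ → σ → σ}
    (hg : Primrec fun p : α × ℕ × σ × σ × σ => g p.1 p.2.1 p.2.2.1 p.2.2.2.1 p.2.2.2.2) :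
    Primrec₂ (cfold d g) := by
  refine Primrec.nat_strong_rec (cfold d g) (g := fun a L => some (g a L.length
    (L.getD L.length.unpair.2 d) (L.getD L.length.unpair.2.unpair.1 d)
    (L.getD L.length.unpair.2.unpair.2 d))) ?_ ?_
  · refine Primrec.option_some.comp ?_
    have hlen : Primrec fun p : α × List σ => p.2.length := Primrec.list_length.comp Primrec.snd
    refine hg.comp (pr_pair Primrec.fst (pr_pair hlen (pr_pair ?_ (pr_pair ?_ ?_))))
    · exact (Primrec.list_getD d).comp Primrec.snd (pr_snd (pr_unpair hlen))
    · exact (Primrec.list_getD d).comp Primrec.snd (pr_fst (pr_unpair (pr_snd (pr_unpair hlen))))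
    · exact (Primrec.list_getD d).comp Primrec.snd (pr_snd (pr_unpair (pr_snd (pr_unpair hlen))))
  · intro a n
    have key : ∀ m, ((List.range n).map (cfold d g a)).getD m d =
        if _h : m < n then cfold d g a m else d := by
      intro m
      by_cases h : m < n <;> simp [List.getD_eq_getElem?_getD, h]
    simp only [key, List.length_map, List.length_range]
    conv_rhs => rw [cfold]

end PR

theorem cfold_un {α σ : Type} {d : σ} {g : α → ℕ → σ → σ → σ → σ} {a : α} {k m : ℕ} (hk : 1 ≤ k) :
    ∃ r2 r3, cfold d g a (Nat.pair k m) = g a (Nat.pair k m) (cfold d g a m) r2 r3 := by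
  have h : m < Nat.pair k m := by have := Nat.add_le_pair k m; omega
  rw [cfold]
  simp only [Nat.unpair_pair]
  rw [dif_pos h]
  exact ⟨_, _, rfl⟩

theorem cfold_bin {α σ : Type} {d : σ} {g : α → ℕ → σ → σ → σ → σ} {a : α} {k m l : ℕ} (hk : 1 ≤ k) :
    ∃ r1, cfold d g a (Nat.pair k (Nat.pair m l)) =
      g a (Nat.pair k (Nat.pair m l)) r1 (cfold d g a m) (cfold d g a l) := by
  have h : Nat.pair m l < Nat.pair k (Nat.pair m l) := by
    have := Nat.add_le_pair k (Nat.pair m l); omega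
  have hm := Nat.left_le_pair m l
  have hl := Nat.right_le_pair m l
  rw [cfold]
  simp only [Nat.unpair_pair]
  rw [dif_pos (lt_of_le_of_lt hm h), dif_pos (lt_of_le_of_lt hl h)]
  exact ⟨_, rfl⟩

theorem cfold_any {α σ : Type} {d : σ} {g : α → ℕ → σ → σ → σ → σ} {a : α} (n : ℕ) :
    ∃ r1 r2 r3, cfold d g a n = g a n r1 r2 r3 := by
  rw [cfold]; exact ⟨_, _, _, rfl⟩

theorem cfold_un_eq {α σ : Type} {d : σ} {g : α → ℕ → σ → σ → σ → σ} {a : α} {k m : ℕ} {v : σ}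
    (h : ∀ r2 r3, g a (Nat.pair k m) (cfold d g a m) r2 r3 = v) (hk : 1 ≤ k) :
    cfold d g a (Nat.pair k m) = v := by
  obtain ⟨r2, r3, h'⟩ := cfold_un (d := d) (g := g) (a := a) (m := m) hk
  rw [h', h]

theorem cfold_bin_eq {α σ : Type} {d : σ} {g : α → ℕ → σ → σ → σ → σ} {a : α} {k m l : ℕ} {v : σ}
    (h : ∀ r1, g a (Nat.pair k (Nat.pair m l)) r1 (cfold d g a m) (cfold d g a l) = v)
    (hk : 1 ≤ k) : cfold d g a (Nat.pair k (Nat.pair m l)) = v := by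
  obtain ⟨r1, h'⟩ := cfold_bin (d := d) (g := g) (a := a) (m := m) (l := l) hk
  rw [h', h]

theorem cfold_any_eq {α σ : Type} {d : σ} {g : α → ℕ → σ → σ → σ → σ} {a : α} {n : ℕ} {v : σ}
    (h : ∀ r1 r2 r3, g a n r1 r2 r3 = v) : cfold d g a n = v := by
  obtain ⟨r1, r2, r3, h'⟩ := cfold_any (d := d) (g := g) (a := a) n
  rw [h', h]

/-! ## Part 6 : operations on codes -/

/-- Step function: free occurrence of the variable x. -/
def gFv (x n : ℕ) (r1 r2 r3 : Bool) : Bool :=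
  bif n.unpair.1 == 0 then false else
  bif n.unpair.1 == 1 then false else
  bif n.unpair.1 == 2 then (dl n.unpair.2.unpair.2).any (fun a => a == 2 * x) else
  bif n.unpair.1 == 3 then r1 else
  bif n.unpair.1 == 11 || n.unpair.1 == 12 then !(n.unpair.2.unpair.1 == x) && r3 else
  r2 || r3

def cFv : ℕ → ℕ → Bool := cfold false gFv

theorem pr_cFv {α : Type} [Primcodable α] {f g : α → ℕ} (hf : Primrec f) (hg : Primrec g) :
    Primrec fun a => cFv (f a) (g a) := by
  refine (pr_cfold (g := gFv) false ?_).comp hf hg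
  unfold gFv
  repeat' (with_reducible first
    | assumption
    | exact Primrec.const _
    | exact Primrec.id
    | exact Primrec.fst
    | exact Primrec.snd
    | apply pr_cond
    | apply pr_fst
    | apply pr_snd
    | apply pr_beq
    | apply pr_unpair
    | apply pr_any
    | apply pr_dl
    | apply pr_not
    | apply pr_and
    | apply pr_or
    | apply pr_mul)

/-- Step function: substitution of the term coded by p.2 for the variable p.1. -/
def gSubst (p : ℕ × ℕ) (n : ℕ) (r1 r2 r3 : ℕ) : ℕ :=
  bif n.unpair.1 == 0 then n else
  bif n.unpair.1 == 1 then n else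
  bif n.unpair.1 == 2 then Nat.pair 2 (Nat.pair n.unpair.2.unpair.1
    (Encodable.encode ((dl n.unpair.2.unpair.2).map fun a => bif a == 2 * p.1 then p.2 else a))) else
  bif n.unpair.1 == 3 then Nat.pair 3 r1 else
  bif (n.unpair.1 == 11 || n.unpair.1 == 12) && n.unpair.2.unpair.1 == p.1 then n else
  bif (n.unpair.1 == 11 || n.unpair.1 == 12) then
    Nat.pair n.unpair.1 (Nat.pair n.unpair.2.unpair.1 r3) else
  Nat.pair n.unpair.1 (Nat.pair r2 r3)

def cSubst : ℕ × ℕ → ℕ → ℕ := cfold 0 gSubst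

theorem pr_cSubst {α : Type} [Primcodable α] {f : α → ℕ × ℕ} {g : α → ℕ} (hf : Primrec f)
    (hg : Primrec g) : Primrec fun a => cSubst (f a) (g a) := by
  refine (pr_cfold (g := gSubst) 0 ?_).comp hf hg
  unfold gSubst
  repeat' (with_reducible first
    | assumption
    | exact Primrec.const _
    | exact Primrec.id
    | exact Primrec.fst
    | exact Primrec.snd
    | apply pr_cond
    | apply pr_fst
    | apply pr_snd
    | apply pr_beq
    | apply pr_unpair
    | apply pr_map
    | apply pr_dl
    | apply pr_not
    | apply pr_and
    | apply pr_or
    | apply pr_mul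
    | apply pr_npair
    | apply pr_encode)

/-- Step function: substituting the term coded by p.2 for the variable p.1 causes a capture. -/
def gCapt (p : ℕ × ℕ) (n : ℕ) (r1 r2 r3 : Bool) : Bool :=
  bif n.unpair.1 == 0 then false else
  bif n.unpair.1 == 1 then false else
  bif n.unpair.1 == 2 then false else
  bif n.unpair.1 == 3 then r1 else
  bif n.unpair.1 == 11 || n.unpair.1 == 12 then
    !(p.1 == n.unpair.2.unpair.1) &&
      ((2 * n.unpair.2.unpair.1 == p.2 && cFv p.1 n.unpair.2.unpair.2) || r3) else
  r2 || r3

def cCapt : ℕ × ℕ → ℕ → Bool := cfold false gCapt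

theorem pr_cCapt {α : Type} [Primcodable α] {f : α → ℕ × ℕ} {g : α → ℕ} (hf : Primrec f)
    (hg : Primrec g) : Primrec fun a => cCapt (f a) (g a) := by
  refine (pr_cfold (g := gCapt) false ?_).comp hf hg
  unfold gCapt
  repeat' (with_reducible first
    | assumption
    | exact Primrec.const _
    | exact Primrec.id
    | exact Primrec.fst
    | exact Primrec.snd
    | apply pr_cond
    | apply pr_fst
    | apply pr_snd
    | apply pr_beq
    | apply pr_unpair
    | apply pr_not
    | apply pr_and
    | apply pr_or
    | apply pr_mul
    | apply pr_cFv)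

/-- Step function: truth value of the elementarization at both signs. -/
def gPev (m n : ℕ) (r1 r2 r3 : Bool × Bool) : Bool × Bool :=
  bif n.unpair.1 == 0 then (true, true) else
  bif n.unpair.1 == 1 then (false, false) else
  bif n.unpair.1 == 2 then (m / 2 ^ n % 2 == 1, m / 2 ^ n % 2 == 1) else
  bif n.unpair.1 == 3 then (!r1.2, !r1.1) else
  bif n.unpair.1 == 4 then (r2.1 && r3.1, r2.2 && r3.2) else
  bif n.unpair.1 == 5 then (r2.1 || r3.1, r2.2 || r3.2) else
  bif n.unpair.1 == 6 then (!r2.2 || r3.1, !r2.1 || r3.2) else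
  bif n.unpair.1 == 9 || n.unpair.1 == 11 then (true, false) else (false, true)

def cPev : ℕ → ℕ → Bool × Bool := cfold (false, false) gPev

theorem pr_cPev {α : Type} [Primcodable α] {f g : α → ℕ} (hf : Primrec f) (hg : Primrec g) :
    Primrec fun a => cPev (f a) (g a) := by
  refine (pr_cfold (g := gPev) (false, false) ?_).comp hf hg
  unfold gPev
  repeat' (with_reducible first
    | assumption
    | exact Primrec.const _
    | exact Primrec.id
    | exact Primrec.fst
    | exact Primrec.snd
    | apply pr_cond
    | apply pr_fst
    | apply pr_snd
    | apply pr_beq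
    | apply pr_unpair
    | apply pr_not
    | apply pr_and
    | apply pr_or
    | apply pr_mod
    | apply pr_div
    | apply pr_two_pow
    | apply pr_pair)

/-- Moves at a choice quantifier. -/
def qMv (t n : ℕ) : List ℕ :=
  bif cCapt (n.unpair.2.unpair.1, t) n.unpair.2.unpair.2 then [] else
    [cSubst (n.unpair.2.unpair.1, t) n.unpair.2.unpair.2]

theorem pr_qMv {α : Type} [Primcodable α] {f g : α → ℕ} (hf : Primrec f) (hg : Primrec g) :
    Primrec fun a => qMv (f a) (g a) := by
  unfold qMv
  repeat' (with_reducible first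
    | assumption
    | exact Primrec.const _
    | exact Primrec.id
    | exact Primrec.fst
    | exact Primrec.snd
    | apply pr_cond
    | apply pr_fst
    | apply pr_snd
    | apply pr_unpair
    | apply pr_pair
    | apply pr_cCapt
    | apply pr_cSubst
    | apply pr_cons)

/-- Combining moves of the two components of a binary connective. -/
def bMv (n : ℕ) (L1 L2 : List ℕ) : List ℕ :=
  L1.map (fun k => Nat.pair n.unpair.1 (Nat.pair k n.unpair.2.unpair.2)) ++
  L2.map (fun k => Nat.pair n.unpair.1 (Nat.pair n.unpair.2.unpair.1 k))

theorem pr_bMv {α : Type} [Primcodable α] {f : α → ℕ} {g h : α → List ℕ} (hf : Primrec f)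
    (hg : Primrec g) (hh : Primrec h) : Primrec fun a => bMv (f a) (g a) (h a) := by
  have : Primrec fun p : ℕ × List ℕ × List ℕ => bMv p.1 p.2.1 p.2.2 := by
    unfold bMv
    repeat' (with_reducible first
      | assumption
      | exact Primrec.const _
      | exact Primrec.id
      | exact Primrec.fst
      | exact Primrec.snd
      | apply pr_fst
      | apply pr_snd
      | apply pr_unpair
      | apply pr_append
      | apply pr_map
      | apply pr_npair)
  exact Primrec.comp (f := fun p : ℕ × List ℕ × List ℕ => bMv p.1 p.2.1 p.2.2)
    (g := fun a => (f a, g a, h a)) this (pr_pair hf (pr_pair hg hh))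

/-- Step function: the list of moves with term code t, at both signs. -/
def gMv (t n : ℕ) (r1 r2 r3 : List ℕ × List ℕ) : List ℕ × List ℕ :=
  bif n.unpair.1 == 3 then (r1.2.map (fun k => Nat.pair 3 k), r1.1.map (fun k => Nat.pair 3 k)) else
  bif n.unpair.1 == 4 || n.unpair.1 == 5 then (bMv n r2.1 r3.1, bMv n r2.2 r3.2) else
  bif n.unpair.1 == 6 then (bMv n r2.2 r3.1, bMv n r2.1 r3.2) else
  bif n.unpair.1 == 9 then ([], [n.unpair.2.unpair.1, n.unpair.2.unpair.2]) else
  bif n.unpair.1 == 10 then ([n.unpair.2.unpair.1, n.unpair.2.unpair.2], []) else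
  bif n.unpair.1 == 11 then ([], qMv t n) else
  bif n.unpair.1 == 12 then (qMv t n, []) else ([], [])

def cMv : ℕ → ℕ → List ℕ × List ℕ := cfold ([], []) gMv

theorem pr_cMv {α : Type} [Primcodable α] {f g : α → ℕ} (hf : Primrec f) (hg : Primrec g) :
    Primrec fun a => cMv (f a) (g a) := by
  refine (pr_cfold (g := gMv) ([], []) ?_).comp hf hg
  unfold gMv
  repeat' (with_reducible first
    | assumption
    | exact Primrec.const _
    | exact Primrec.id
    | exact Primrec.fst
    | exact Primrec.snd
    | apply pr_cond
    | apply pr_beq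
    | apply pr_fst
    | apply pr_snd
    | apply pr_unpair
    | apply pr_or
    | apply pr_pair
    | apply pr_map
    | apply pr_npair
    | apply pr_bMv
    | apply pr_qMv
    | apply pr_cons)

/-! ### Correctness -/

theorem Term.code_inj {t u : Term} (h : t.code = u.code) : t = u := by
  cases t <;> cases u <;> simp only [Term.code, Term.var.injEq, Term.const.injEq,
    reduceCtorEq] at * <;> omega

theorem Term.code_inj_iff {t u : Term} : t.code = u.code ↔ t = u :=
  ⟨Term.code_inj, fun h => by rw [h]⟩

theorem cFv_spec {x : ℕ} {F : Fml} (hF : F.blindFree) :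
    cFv x F.code = decide (x ∈ F.freeVars) := by
  unfold cFv
  induction F with
  | top | bot =>
    rw [Fml.code]
    refine cfold_any_eq fun r1 r2 r3 => ?_
    simp [gFv, Fml.freeVars]
  | atom p args =>
    rw [Fml.code]
    refine cfold_any_eq fun r1 r2 r3 => ?_
    rw [Bool.eq_iff_iff]
    simp only [gFv, Fml.freeVars, mem_foldr_vars, Nat.unpair_pair, dl_listCode, decide_eq_true_eq]
    simp only [Nat.reduceBEq, cond_true, cond_false, List.any_map, List.any_eq_true,
      Function.comp, beq_iff_eq]
    constructor
    · rintro ⟨t, ht, he⟩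
      rwa [← Term.code_inj (t := t) (u := .var x) he]
    · intro h
      exact ⟨_, h, rfl⟩
  | neg F ih =>
    rw [Fml.code]
    refine cfold_un_eq (fun r2 r3 => ?_) (by norm_num)
    rw [ih hF, Bool.eq_iff_iff]
    simp [gFv, Fml.freeVars]
    exact decide_eq_true_iff.symm
  | and F G ihF ihG | or F G ihF ihG | imp F G ihF ihG | chand F G ihF ihG | chor F G ihF ihG =>
    rw [Fml.code]
    refine cfold_bin_eq (fun r1 => ?_) (by norm_num)
    rw [ihF hF.1, ihG hF.2, Bool.eq_iff_iff]
    simp [gFv, Fml.freeVars]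
  | all | ex => exact hF.elim
  | chall y F ih | chex y F ih =>
    rw [Fml.code]
    refine cfold_bin_eq (fun r1 => ?_) (by norm_num)
    rw [ih hF, Bool.eq_iff_iff]
    simp [gFv, Fml.freeVars, @eq_comm _ x y]

theorem cSubst_spec {x : ℕ} {u : Term} {F : Fml} (hF : F.blindFree) :
    cSubst (x, u.code) F.code = (F.subst x u).code := by
  unfold cSubst
  induction F with
  | top | bot =>
    rw [Fml.code]
    refine cfold_any_eq fun r1 r2 r3 => ?_
    simp [gSubst, Fml.subst, Fml.code]
  | atom p args =>
    rw [Fml.code]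
    refine cfold_any_eq fun r1 r2 r3 => ?_
    simp only [gSubst, Fml.subst, Fml.code, Nat.unpair_pair, dl_listCode, ← listCode_eq]
    simp only [Nat.reduceBEq, cond_true, cond_false, List.map_map]
    congr 4
    funext t
    simp only [Function.comp]
    by_cases h : t = .var x
    · subst h; simp [Term.code, Term.subst]
    · have h1 : ¬ (t.code = 2 * x) := fun e => h (Term.code_inj (u := .var x) e)
      rw [show (t.code == 2 * x) = false by simpa using h1, cond_false]
      cases t with
      | var y =>
        have : y ≠ x := fun e => h (by rw [e])
        simp [Term.subst, this]
      | const c => rfl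
  | neg F ih =>
    rw [Fml.code]
    refine cfold_un_eq (fun r2 r3 => ?_) (by norm_num)
    rw [ih hF]
    simp [gSubst, Fml.subst, Fml.code]
  | and F G ihF ihG | or F G ihF ihG | imp F G ihF ihG | chand F G ihF ihG | chor F G ihF ihG =>
    rw [Fml.code]
    refine cfold_bin_eq (fun r1 => ?_) (by norm_num)
    rw [ihF hF.1, ihG hF.2]
    simp [gSubst, Fml.subst, Fml.code]
  | all | ex => exact hF.elim
  | chall y F ih | chex y F ih =>
    rw [Fml.code]
    refine cfold_bin_eq (fun r1 => ?_) (by norm_num)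
    rw [ih hF]
    by_cases h : y = x
    · simp [gSubst, Fml.subst, Fml.code, h]
    · simp only [gSubst, Fml.subst, h, if_false, Fml.code, Nat.unpair_pair,
        show (y == x) = false by simpa using h]
      simp

open Classical in
theorem cCapt_spec' {x : ℕ} {u : Term} {F : Fml} (hF : F.blindFree) :
    cCapt (x, u.code) F.code = decide (∃ v, u = .var v ∧ F.capturesAt x v) := by
  unfold cCapt
  induction F with
  | top | bot | atom =>
    rw [Fml.code]
    refine cfold_any_eq fun r1 r2 r3 => ?_
    simp [gCapt, Fml.capturesAt]
  | neg F ih =>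
    rw [Fml.code]
    refine cfold_un_eq (fun r2 r3 => ?_) (by norm_num)
    rw [ih hF, Bool.eq_iff_iff]
    simp [gCapt, Fml.capturesAt]
    exact decide_eq_true_iff.symm
  | and F G ihF ihG | or F G ihF ihG | imp F G ihF ihG | chand F G ihF ihG | chor F G ihF ihG =>
    rw [Fml.code]
    refine cfold_bin_eq (fun r1 => ?_) (by norm_num)
    rw [ihF hF.1, ihG hF.2, Bool.eq_iff_iff]
    simp [gCapt, Fml.capturesAt, and_or_left, exists_or]
  | all | ex => exact hF.elim
  | chall y F ih | chex y F ih =>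
    rw [Fml.code]
    refine cfold_bin_eq (fun r1 => ?_) (by norm_num)
    rw [ih hF, Bool.eq_iff_iff]
    refine Iff.trans ?_ decide_eq_true_iff.symm
    simp only [gCapt, Nat.unpair_pair, Fml.capturesAt]
    simp only [Nat.reduceBEq, cond_true, cond_false, Bool.and_eq_true, Bool.or_eq_true,
      cFv_spec (F := F) hF, Bool.or_true, Bool.true_or, Bool.not_eq_true', beq_eq_false_iff_ne,
      decide_eq_true_eq, beq_iff_eq]
    have : 2 * y = u.code ↔ u = .var y := by
      rw [← Term.code_inj_iff]; exact eq_comm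
    rw [this]
    constructor
    · rintro ⟨h1, ⟨h2, h3⟩ | ⟨v, h2, h3⟩⟩
      · exact ⟨y, h2, h1, .inl ⟨rfl, h3⟩⟩
      · exact ⟨v, h2, h1, .inr h3⟩
    · rintro ⟨v, h2, h1, ⟨rfl, h3⟩ | h3⟩
      · exact ⟨h1, .inl ⟨h2, h3⟩⟩
      · exact ⟨h1, .inr ⟨v, h2, h3⟩⟩

theorem cCapt_spec {x : ℕ} {u : Term} {F : Fml} (hF : F.blindFree) :
    cCapt (x, u.code) F.code = false ↔ OkSub F x u := by
  rw [cCapt_spec' hF]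
  simp [OkSub]

theorem cPev_spec {m : ℕ} {F : Fml} (hF : F.blindFree) :
    cPev m F.code = (F.pev (fun p args => m.testBit (Fml.atom p args).code) true,
      F.pev (fun p args => m.testBit (Fml.atom p args).code) false) := by
  unfold cPev
  induction F with
  | top | bot =>
    rw [Fml.code]
    refine cfold_any_eq fun r1 r2 r3 => ?_
    simp [gPev, Fml.pev]
  | atom p args =>
    refine cfold_any_eq fun r1 r2 r3 => ?_
    have : (Fml.atom p args).code.unpair.1 = 2 := by simp [Fml.code]
    simp only [gPev, Fml.pev, this, Nat.testBit_eq_decide_div_mod_eq]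
    rfl
  | neg F ih =>
    rw [Fml.code]
    refine cfold_un_eq (fun r2 r3 => ?_) (by norm_num)
    rw [ih hF]
    simp [gPev, Fml.pev]
  | and F G ihF ihG | or F G ihF ihG | imp F G ihF ihG | chand F G ihF ihG | chor F G ihF ihG =>
    rw [Fml.code]
    refine cfold_bin_eq (fun r1 => ?_) (by norm_num)
    rw [ihF hF.1, ihG hF.2]
    simp [gPev, Fml.pev]
  | all | ex => exact hF.elim
  | chall y F ih | chex y F ih =>
    rw [Fml.code]
    refine cfold_any_eq fun r1 r2 r3 => ?_
    simp [gPev, Fml.pev]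

/-- Selecting a component by sign. -/
def sel {β : Type} (s : Bool) (p : β × β) : β := bif s then p.1 else p.2

theorem mem_bMv {k c f g : ℕ} {L1 L2 : List ℕ} :
    k ∈ bMv (Nat.pair c (Nat.pair f g)) L1 L2 ↔
      (∃ a ∈ L1, Nat.pair c (Nat.pair a g) = k) ∨ (∃ b ∈ L2, Nat.pair c (Nat.pair f b) = k) := by
  simp [bMv]

theorem mem_qMv {k c y : ℕ} {t : Term} {G : Fml} (hG : G.blindFree) :
    k ∈ qMv t.code (Nat.pair c (Nat.pair y G.code)) ↔ OkSub G y t ∧ (G.subst y t).code = k := by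
  simp only [qMv, Nat.unpair_pair, ← cCapt_spec hG, cSubst_spec hG]
  cases cCapt (y, t.code) G.code <;> simp [eq_comm]

theorem sel_mk {β : Type} (s : Bool) (a b : β) : sel s (a, b) = bif s then a else b := rfl

theorem cMv_spec {t : Term} {F : Fml} (hF : F.blindFree) : ∀ {s : Bool} {k : ℕ},
    k ∈ sel s (cMv t.code F.code) ↔ ∃ H, Step t s F H ∧ H.code = k := by
  induction F with
  | top | bot | atom =>
    intro s k
    have : ∀ n, n.unpair.1 < 3 → cMv t.code n = ([], []) := by
      intro n hn
      refine cfold_any_eq fun r1 r2 r3 => ?_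
      generalize hm : n.unpair.1 = m at hn
      interval_cases m <;> simp [gMv, hm]
    rw [this _ (by simp [Fml.code])]
    constructor
    · cases s <;> simp [sel]
    · rintro ⟨H, h, -⟩
      cases h with | loc h => cases h
  | neg F ih =>
    intro s k
    have : cMv t.code (Fml.neg F).code = ((cMv t.code F.code).2.map (fun k => Nat.pair 3 k),
        (cMv t.code F.code).1.map (fun k => Nat.pair 3 k)) := by
      unfold cMv
      rw [Fml.code]
      refine cfold_un_eq (fun r2 r3 => ?_) (by norm_num)
      simp [gMv]
    rw [this]
    have : k ∈ sel s ((cMv t.code F.code).2.map (fun k => Nat.pair 3 k),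
        (cMv t.code F.code).1.map (fun k => Nat.pair 3 k)) ↔
        ∃ a ∈ sel (!s) (cMv t.code F.code), Nat.pair 3 a = k := by
      cases s <;> simp [sel]
    rw [this]
    constructor
    · rintro ⟨a, ha, rfl⟩
      obtain ⟨H, h, rfl⟩ := (ih hF).1 ha
      exact ⟨_, .neg h, rfl⟩
    · rintro ⟨H, h, rfl⟩
      cases h with
      | loc h => cases h
      | neg h => exact ⟨_, (ih hF).2 ⟨_, h, rfl⟩, rfl⟩
  | and F G ihF ihG =>
    intro s k
    have : sel s (cMv t.code (Fml.and F G).code) = bMv (Fml.and F G).code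
        (sel s (cMv t.code F.code)) (sel s (cMv t.code G.code)) := by
      have : cMv t.code (Fml.and F G).code = (bMv (Fml.and F G).code (cMv t.code F.code).1
        (cMv t.code G.code).1, bMv (Fml.and F G).code (cMv t.code F.code).2
        (cMv t.code G.code).2) := by
        unfold cMv
        rw [Fml.code]
        refine cfold_bin_eq (fun r1 => ?_) (by norm_num)
        simp [gMv]
      rw [this]; cases s <;> rfl
    rw [this, Fml.code, mem_bMv]
    constructor
    · rintro (⟨a, ha, rfl⟩ | ⟨a, ha, rfl⟩)
      · obtain ⟨H, h, rfl⟩ := (ihF hF.1).1 ha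
        exact ⟨_, .andL _ h, rfl⟩
      · obtain ⟨H, h, rfl⟩ := (ihG hF.2).1 ha
        exact ⟨_, .andR _ h, rfl⟩
    · rintro ⟨H, h, rfl⟩
      cases h with
      | loc h => cases h
      | andL _ h => exact .inl ⟨_, (ihF hF.1).2 ⟨_, h, rfl⟩, rfl⟩
      | andR _ h => exact .inr ⟨_, (ihG hF.2).2 ⟨_, h, rfl⟩, rfl⟩
  | or F G ihF ihG =>
    intro s k
    have : sel s (cMv t.code (Fml.or F G).code) = bMv (Fml.or F G).code
        (sel s (cMv t.code F.code)) (sel s (cMv t.code G.code)) := by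
      have : cMv t.code (Fml.or F G).code = (bMv (Fml.or F G).code (cMv t.code F.code).1
        (cMv t.code G.code).1, bMv (Fml.or F G).code (cMv t.code F.code).2
        (cMv t.code G.code).2) := by
        unfold cMv
        rw [Fml.code]
        refine cfold_bin_eq (fun r1 => ?_) (by norm_num)
        simp [gMv]
      rw [this]; cases s <;> rfl
    rw [this, Fml.code, mem_bMv]
    constructor
    · rintro (⟨a, ha, rfl⟩ | ⟨a, ha, rfl⟩)
      · obtain ⟨H, h, rfl⟩ := (ihF hF.1).1 ha
        exact ⟨_, .orL _ h, rfl⟩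
      · obtain ⟨H, h, rfl⟩ := (ihG hF.2).1 ha
        exact ⟨_, .orR _ h, rfl⟩
    · rintro ⟨H, h, rfl⟩
      cases h with
      | loc h => cases h
      | orL _ h => exact .inl ⟨_, (ihF hF.1).2 ⟨_, h, rfl⟩, rfl⟩
      | orR _ h => exact .inr ⟨_, (ihG hF.2).2 ⟨_, h, rfl⟩, rfl⟩
  | imp F G ihF ihG =>
    intro s k
    have : sel s (cMv t.code (Fml.imp F G).code) = bMv (Fml.imp F G).code
        (sel (!s) (cMv t.code F.code)) (sel s (cMv t.code G.code)) := by
      have : cMv t.code (Fml.imp F G).code = (bMv (Fml.imp F G).code (cMv t.code F.code).2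
        (cMv t.code G.code).1, bMv (Fml.imp F G).code (cMv t.code F.code).1
        (cMv t.code G.code).2) := by
        unfold cMv
        rw [Fml.code]
        refine cfold_bin_eq (fun r1 => ?_) (by norm_num)
        simp [gMv]
      rw [this]; cases s <;> rfl
    rw [this, Fml.code, mem_bMv]
    constructor
    · rintro (⟨a, ha, rfl⟩ | ⟨a, ha, rfl⟩)
      · obtain ⟨H, h, rfl⟩ := (ihF hF.1).1 ha
        exact ⟨_, .impL _ h, rfl⟩
      · obtain ⟨H, h, rfl⟩ := (ihG hF.2).1 ha
        exact ⟨_, .impR _ h, rfl⟩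
    · rintro ⟨H, h, rfl⟩
      cases h with
      | loc h => cases h
      | impL _ h => exact .inl ⟨_, (ihF hF.1).2 ⟨_, h, rfl⟩, rfl⟩
      | impR _ h => exact .inr ⟨_, (ihG hF.2).2 ⟨_, h, rfl⟩, rfl⟩
  | all | ex => exact hF.elim
  | chand F G =>
    intro s k
    have : cMv t.code (Fml.chand F G).code = ([], [F.code, G.code]) := by
      unfold cMv
      rw [Fml.code]
      refine cfold_bin_eq (fun r1 => ?_) (by norm_num)
      simp [gMv]
    rw [this, sel_mk]
    constructor
    · intro h
      cases s with
      | true => simp at h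
      | false =>
        simp only [cond_false, List.mem_cons, List.not_mem_nil, or_false] at h
        rcases h with rfl | rfl
        · exact ⟨_, .loc (.chandL _ _), rfl⟩
        · exact ⟨_, .loc (.chandR _ _), rfl⟩
    · rintro ⟨H, h, rfl⟩
      cases h with | loc h => cases h <;> simp
  | chor F G =>
    intro s k
    have : cMv t.code (Fml.chor F G).code = ([F.code, G.code], []) := by
      unfold cMv
      rw [Fml.code]
      refine cfold_bin_eq (fun r1 => ?_) (by norm_num)
      simp [gMv]
    rw [this, sel_mk]
    constructor
    · intro h
      cases s with
      | false => simp at h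
      | true =>
        simp only [cond_true, List.mem_cons, List.not_mem_nil, or_false] at h
        rcases h with rfl | rfl
        · exact ⟨_, .loc (.chorL _ _), rfl⟩
        · exact ⟨_, .loc (.chorR _ _), rfl⟩
    · rintro ⟨H, h, rfl⟩
      cases h with | loc h => cases h <;> simp
  | chall x G =>
    intro s k
    have : cMv t.code (Fml.chall x G).code = ([], qMv t.code (Fml.chall x G).code) := by
      unfold cMv
      rw [Fml.code]
      refine cfold_bin_eq (fun r1 => ?_) (by norm_num)
      simp [gMv]
    rw [this, sel_mk, Fml.code]
    constructor
    · intro h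
      cases s with
      | true => simp at h
      | false =>
        obtain ⟨h1, rfl⟩ := (mem_qMv (G := G) hF).1 h
        exact ⟨_, .loc (.chall _ _ h1), rfl⟩
    · rintro ⟨H, h, rfl⟩
      cases h with
      | loc h => cases h with
        | chall _ _ h =>
          rw [cond_false]
          exact (mem_qMv (G := G) hF).2 ⟨h, rfl⟩
  | chex x G =>
    intro s k
    have : cMv t.code (Fml.chex x G).code = (qMv t.code (Fml.chex x G).code, []) := by
      unfold cMv
      rw [Fml.code]
      refine cfold_bin_eq (fun r1 => ?_) (by norm_num)
      simp [gMv]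
    rw [this, sel_mk, Fml.code]
    constructor
    · intro h
      cases s with
      | false => simp at h
      | true =>
        obtain ⟨h1, rfl⟩ := (mem_qMv (G := G) hF).1 h
        exact ⟨_, .loc (.chex _ _ h1), rfl⟩
    · rintro ⟨H, h, rfl⟩
      cases h with
      | loc h => cases h with
        | chex _ _ h =>
          rw [cond_true]
          exact (mem_qMv (G := G) hF).2 ⟨h, rfl⟩

/-! ### The decision procedure -/

/-- Decoding of terms. -/
def tdec (n : ℕ) : Term := if n % 2 = 0 then .var (n / 2) else .const (n / 2)

theorem tdec_code (t : Term) : tdec t.code = t := by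
  cases t with
  | var x => simp [tdec, Term.code]
  | const c =>
    have h1 : (2 * c + 1) % 2 = 1 := by omega
    have h2 : (2 * c + 1) / 2 = c := by omega
    simp [tdec, Term.code, h1, h2]

theorem code_tdec (n : ℕ) : (tdec n).code = n := by
  unfold tdec
  split
  · simp only [Term.code]; omega
  · simp only [Term.code]; omega

theorem Fml.pev_congr {A B : ℕ → List Term → Bool} {F : Fml}
    (h : ∀ p args, (Fml.atom p args).code ≤ F.code → A p args = B p args) (s : Bool) :
    F.pev A s = F.pev B s := by
  induction F generalizing s with
  | top | bot => rfl
  | atom p args => exact h p args le_rfl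
  | neg F ih =>
    simp only [Fml.pev]
    rw [ih fun p args hp => h p args (hp.trans (Nat.right_le_pair _ _))]
  | and F G ihF ihG | or F G ihF ihG | imp F G ihF ihG =>
    simp only [Fml.pev]
    rw [ihF fun p args hp => h p args
        (hp.trans ((Nat.left_le_pair _ _).trans (Nat.right_le_pair _ _))),
      ihG fun p args hp => h p args
        (hp.trans ((Nat.right_le_pair _ _).trans (Nat.right_le_pair _ _)))]
  | all | ex | chand | chor | chall | chex => rfl

/-- Deciding tautologies on codes. -/
def cTaut (n : ℕ) : Bool := (List.range (2 ^ (n + 1))).all fun m => (cPev m n).1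

theorem cTaut_spec {F : Fml} (hF : F.blindFree) : cTaut F.code = true ↔ F.Taut := by
  simp only [cTaut, List.all_eq_true, List.mem_range, cPev_spec hF]
  constructor
  · intro h A
    let f : Fin (F.code + 1) → Bool := fun i =>
      A i.1.unpair.2.unpair.1 ((dl i.1.unpair.2.unpair.2).map tdec)
    have := h (Nat.ofBits f) (Nat.ofBits_lt_two_pow f)
    refine Eq.trans (Fml.pev_congr (fun p args hp => ?_) true) this
    rw [Nat.testBit_ofBits_lt f _ (Nat.lt_succ_of_le hp)]
    simp [f, Fml.code, Function.comp_def, tdec_code]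
  · intro h m _
    exact h _

theorem pr_cTaut {α : Type} [Primcodable α] {f : α → ℕ} (hf : Primrec f) :
    Primrec fun a => cTaut (f a) := by
  unfold cTaut
  repeat' (with_reducible first
    | assumption
    | exact Primrec.const _
    | exact Primrec.id
    | exact Primrec.fst
    | exact Primrec.snd
    | exact hf.comp Primrec.fst
    | apply pr_all
    | apply pr_fst
    | apply pr_range
    | apply pr_two_pow
    | apply pr_add
    | apply pr_cPev)

/-- Moves for the rules B. -/
def bm (n : ℕ) : List ℕ := (List.range (2 * n + 4)).flatMap fun t => (cMv t n).1

/-- Moves for rule A. -/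
def am (n : ℕ) : List ℕ := (cMv (2 * (n + 1)) n).2

theorem mem_bm {F : Fml} (hF : F.blindFree) {k : ℕ} :
    k ∈ bm F.code ↔ ∃ t : Term, t.code < 2 * F.code + 4 ∧ ∃ H, Step t true F H ∧ H.code = k := by
  simp only [bm, List.mem_flatMap, List.mem_range]
  constructor
  · rintro ⟨n, hn, hk⟩
    rw [← code_tdec n] at hn hk
    exact ⟨tdec n, hn, (cMv_spec hF (s := true)).1 hk⟩
  · rintro ⟨t, ht, h⟩
    exact ⟨t.code, ht, (cMv_spec hF (s := true)).2 h⟩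

theorem mem_am {F : Fml} (hF : F.blindFree) {k : ℕ} :
    k ∈ am F.code ↔ ∃ H, Step (.var (F.code + 1)) false F H ∧ H.code = k :=
  cMv_spec (t := .var (F.code + 1)) hF (s := false)

theorem pr_bm {α : Type} [Primcodable α] {f : α → ℕ} (hf : Primrec f) :
    Primrec fun a => bm (f a) := by
  unfold bm
  repeat' (with_reducible first
    | assumption
    | exact Primrec.const _
    | exact Primrec.id
    | exact Primrec.fst
    | exact Primrec.snd
    | exact hf.comp Primrec.fst
    | apply pr_flatMap
    | apply pr_fst
    | apply pr_range
    | apply pr_mul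
    | apply pr_add
    | apply pr_cMv)

theorem pr_am {α : Type} [Primcodable α] {f : α → ℕ} (hf : Primrec f) :
    Primrec fun a => am (f a) := by
  unfold am
  repeat' (with_reducible first
    | assumption
    | exact Primrec.const _
    | apply pr_snd
    | apply pr_mul
    | apply pr_add
    | apply pr_cMv)

/-- One round of closure under moves. -/
def rStep (L : List ℕ) : List ℕ := L ++ L.flatMap fun n => bm n ++ am n

/-- Codes reachable in at most N moves. -/
def rList (N n : ℕ) : List ℕ := rStep^[N] [n]

/-- Membership test. -/
def memb (S : List ℕ) (k : ℕ) : Bool := S.any fun a => a == k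

theorem memb_iff {S : List ℕ} {k : ℕ} : memb S k = true ↔ k ∈ S := by
  simp [memb]

/-- Derivable in one step from S. -/
def okc (S : List ℕ) (n : ℕ) : Bool :=
  (bm n).any (fun k => memb S k) || (cTaut n && (am n).all (fun k => memb S k))

/-- Codes in R derivable with a proof of height at most k. -/
def sList (R : List ℕ) (k : ℕ) : List ℕ := (fun S => R.filter fun n => okc S n)^[k] []

/-- The decision procedure. -/
def decf (n : ℕ) : Bool := memb (sList (rList n n) (n + 1)) n

theorem pr_rStep : Primrec rStep := by
  unfold rStep
  refine pr_append Primrec.id (pr_flatMap Primrec.id (pr_append (pr_bm Primrec.snd)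
    (pr_am Primrec.snd)))

theorem pr_memb {α : Type} [Primcodable α] {f : α → List ℕ} {g : α → ℕ} (hf : Primrec f)
    (hg : Primrec g) : Primrec fun a => memb (f a) (g a) := by
  unfold memb
  exact pr_any hf (pr_beq Primrec.snd (hg.comp Primrec.fst))

theorem pr_okc {α : Type} [Primcodable α] {f : α → List ℕ} {g : α → ℕ} (hf : Primrec f)
    (hg : Primrec g) : Primrec fun a => okc (f a) (g a) := by
  unfold okc
  exact pr_or (pr_any (pr_bm hg) (pr_memb (hf.comp Primrec.fst) Primrec.snd))
    (pr_and (pr_cTaut hg) (pr_all (pr_am hg) (pr_memb (hf.comp Primrec.fst) Primrec.snd)))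

theorem pr_rList : Primrec fun n : ℕ => rList n n := by
  unfold rList
  exact Primrec.nat_iterate (h := fun (_ : ℕ) (L : List ℕ) => rStep L)
    (g := fun n : ℕ => [n]) (f := fun n : ℕ => n) Primrec.id
    (pr_cons Primrec.id (Primrec.const [])) (pr_rStep.comp Primrec.snd)

theorem pr_decf : Primrec decf := by
  unfold decf
  refine pr_memb ?_ Primrec.id
  unfold sList
  refine Primrec.nat_iterate (f := fun n : ℕ => n + 1) (g := fun _ => ([] : List ℕ))
    (h := fun (n : ℕ) (S : List ℕ) => (rList n n).filter fun k => okc S k)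
    (pr_add Primrec.id (Primrec.const 1)) (Primrec.const _) ?_
  exact pr_filter (f := fun p : ℕ × List ℕ => rList p.1 p.1)
    (g := fun p k => okc p.2 k) (pr_rList.comp Primrec.fst)
    (pr_okc (Primrec.snd.comp Primrec.fst) Primrec.snd)

theorem rList_mono {N M n : ℕ} (h : N ≤ M) : rList N n ⊆ rList M n := by
  induction M, h using Nat.le_induction with
  | base => exact fun _ h => h
  | succ M _ ih =>
    intro k hk
    rw [rList, Function.iterate_succ_apply']
    exact List.mem_append_left _ (ih hk)

theorem rList_succ {N n k l : ℕ} (h : k ∈ rList N n) (hl : l ∈ bm k ++ am k) :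
    l ∈ rList (N + 1) n := by
  rw [rList, Function.iterate_succ_apply']
  exact List.mem_append_right _ (List.mem_flatMap.2 ⟨k, h, hl⟩)

theorem mem_sList_succ {R : List ℕ} {k n : ℕ} :
    n ∈ sList R (k + 1) ↔ n ∈ R ∧ okc (sList R k) n = true := by
  rw [sList, Function.iterate_succ_apply', List.mem_filter]
  rfl

/-- Number of choice operators. -/
def Fml.cnt : Fml → ℕ
  | .top => 0
  | .bot => 0
  | .atom _ _ => 0
  | .neg F => F.cnt
  | .and F G => F.cnt + G.cnt
  | .or F G => F.cnt + G.cnt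
  | .imp F G => F.cnt + G.cnt
  | .all _ F => F.cnt
  | .ex _ F => F.cnt
  | .chand F G => F.cnt + G.cnt + 1
  | .chor F G => F.cnt + G.cnt + 1
  | .chall _ F => F.cnt + 1
  | .chex _ F => F.cnt + 1

theorem Fml.cnt_subst (F : Fml) (x : ℕ) (u : Term) : (F.subst x u).cnt = F.cnt := by
  induction F with
  | top | bot | atom => rfl
  | neg F ih => simpa [Fml.subst, Fml.cnt] using ih
  | and F G ihF ihG | or F G ihF ihG | imp F G ihF ihG | chand F G ihF ihG | chor F G ihF ihG =>
    simp [Fml.subst, Fml.cnt, ihF, ihG]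
  | all y F ih | ex y F ih | chall y F ih | chex y F ih =>
    simp only [Fml.subst]
    split
    · rfl
    · simp [Fml.cnt, ih]

theorem Step.cnt_lt {t s F H} (h : Step t s F H) : H.cnt < F.cnt := by
  induction h with
  | loc h => cases h <;> simp only [Fml.cnt, Fml.cnt_subst] <;> omega
  | neg _ ih => exact ih
  | andL _ _ ih | orL _ _ ih | impL _ _ ih => simp only [Fml.cnt]; omega
  | andR _ _ ih | orR _ _ ih | impR _ _ ih => simp only [Fml.cnt]; omega

theorem add_le_npair (a b c : ℕ) : a + b ≤ Nat.pair c (Nat.pair a b) :=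
  (Nat.add_le_pair a b).trans (Nat.right_le_pair _ _)

theorem add_lt_npair {a b c : ℕ} (hc : 0 < c) : a + b + 1 ≤ Nat.pair c (Nat.pair a b) := by
  have h1 := Nat.add_le_pair a b
  have h2 := Nat.add_le_pair c (Nat.pair a b)
  omega

theorem Fml.cnt_le_code (F : Fml) : F.cnt ≤ F.code := by
  induction F with
  | top | bot | atom => exact Nat.zero_le _
  | neg F ih => exact ih.trans (Nat.right_le_pair _ _)
  | and F G ihF ihG | or F G ihF ihG | imp F G ihF ihG =>
    exact (Nat.add_le_add ihF ihG).trans (add_le_npair _ _ _)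
  | chand F G ihF ihG | chor F G ihF ihG =>
    exact (Nat.succ_le_succ (Nat.add_le_add ihF ihG)).trans (add_lt_npair (by norm_num))
  | all y F ih | ex y F ih =>
    exact (ih.trans (Nat.le_add_left _ y)).trans (add_le_npair _ _ _)
  | chall y F ih | chex y F ih =>
    exact (Nat.succ_le_succ (ih.trans (Nat.le_add_left _ y))).trans (add_lt_npair (by norm_num))

theorem okc_iff {S : List ℕ} {F : Fml} (hF : F.blindFree) : okc S F.code = true ↔
    (∃ t : Term, t.code < 2 * F.code + 4 ∧ ∃ H, Step t true F H ∧ H.code ∈ S) ∨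
    (F.Taut ∧ ∀ H, Step (.var (F.code + 1)) false F H → H.code ∈ S) := by
  simp only [okc, Bool.or_eq_true, Bool.and_eq_true, List.any_eq_true, List.all_eq_true,
    memb_iff, cTaut_spec hF, mem_bm hF, mem_am hF]
  refine or_congr ?_ (and_congr Iff.rfl ?_)
  · constructor
    · rintro ⟨_, ⟨t, ht, H, hs, rfl⟩, hm⟩
      exact ⟨t, ht, H, hs, hm⟩
    · rintro ⟨t, ht, H, hs, hm⟩
      exact ⟨_, ⟨t, ht, H, hs, rfl⟩, hm⟩
  · constructor
    · intro h H hs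
      exact h _ ⟨H, hs, rfl⟩
    · rintro h _ ⟨H, hs, rfl⟩
      exact h H hs

theorem sList_sound {R : List ℕ} {k : ℕ} : ∀ {F : Fml}, F.blindFree →
    F.code ∈ sList R k → Prov2 F := by
  induction k with
  | zero => intro F _ h; simp [sList] at h
  | succ k ih =>
    intro F hF h
    rw [mem_sList_succ, okc_iff hF] at h
    rw [Prov2.finitary]
    rcases h.2 with ⟨t, ht, H, hs, hm⟩ | ⟨hT, h⟩
    · exact .inl ⟨t, ht, H, hs, ih (hs.blindFree hF) hm⟩
    · exact .inr ⟨hT, fun H hs => ih (hs.blindFree hF) (h H hs)⟩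

theorem sList_complete {N n c : ℕ} : ∀ {F : Fml}, F.blindFree → F.cnt ≤ c → Prov2 F →
    ∀ {j k : ℕ}, F.code ∈ rList j n → j + F.cnt ≤ N → F.cnt < k →
      F.code ∈ sList (rList N n) k := by
  induction c with
  | zero =>
    intro F hF hc hp j k hj hN hk
    obtain ⟨k, rfl⟩ : ∃ l, k = l + 1 := ⟨k - 1, by omega⟩
    rw [mem_sList_succ, okc_iff hF]
    refine ⟨rList_mono (by omega) hj, ?_⟩
    rcases Prov2.finitary.1 hp with ⟨t, ht, H, hs, hm⟩ | ⟨hT, h⟩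
    · have := hs.cnt_lt; omega
    · exact .inr ⟨hT, fun H hs => by have := hs.cnt_lt; omega⟩
  | succ c ih =>
    intro F hF hc hp j k hj hN hk
    obtain ⟨k, rfl⟩ : ∃ l, k = l + 1 := ⟨k - 1, by omega⟩
    rw [mem_sList_succ, okc_iff hF]
    refine ⟨rList_mono (by omega) hj, ?_⟩
    rcases Prov2.finitary.1 hp with ⟨t, ht, H, hs, hm⟩ | ⟨hT, h⟩
    · have := hs.cnt_lt
      refine .inl ⟨t, ht, H, hs, ih (hs.blindFree hF) (by omega) hm (j := j + 1)
        (rList_succ hj ?_) (by omega) (by omega)⟩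
      exact List.mem_append_left _ ((mem_bm hF).2 ⟨t, ht, H, hs, rfl⟩)
    · refine .inr ⟨hT, fun H hs => ?_⟩
      have := hs.cnt_lt
      refine ih (hs.blindFree hF) (by omega) (h H hs) (j := j + 1)
        (rList_succ hj ?_) (by omega) (by omega)
      exact List.mem_append_right _ ((mem_am hF).2 ⟨H, hs, rfl⟩)

/-- the ∀,∃-free fragment of CL2 is decidable: some computable
function decides, on codes of blind-quantifier-free formulas, CL2-provability. -/
theorem blindFree_fragment_decidable :
    ∃ f : ℕ → Bool, Computable f ∧
      ∀ F : Fml, F.blindFree → (f F.code = true ↔ Prov F) := by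
  refine ⟨decf, pr_decf.to_comp, fun F hF => ?_⟩
  rw [decf, memb_iff]
  constructor
  · intro h
    exact (sList_sound hF h).toProv hF
  · intro h
    have hc := F.cnt_le_code
    exact sList_complete hF le_rfl (h.toProv2 hF) (j := 0) (by simp [rList]) (by omega) (by omega)
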